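/- (Theorem 3.9, parts i–ii) Assume 0<h<2 with 2/h∉ℤ, h small and L large; set λ=⌊2/h⌋+1. For the PCA started from the all-minus configuration −1̲: (i) the system visits the set 𝒫_{−1̲} of protocritical droplets before visiting the chessboards, i.e. ℙ_{−1̲}(τ_{𝒫_{−1̲}} < τ_𝒞) → 1 as β→∞; (ii) the system visits the chessboards before reaching the all-plus configuration, i.e. ℙ_{−1̲}(τ_𝒞 < τ_{+1̲}) → 1 as β→∞. -/

import Mathlib

open scoped BigOperators Classical
open Filter

namespace PCA

/-- Sites of the two-dimensional discrete torus of side `L`. -/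
abbrev Site (L : ℕ) := ZMod L × ZMod L

/-- Spin configurations: `true` codes the spin `+1`, `false` codes `-1`. -/
abbrev Config (L : ℕ) := Site L → Bool

noncomputable section

/-- The real value of a spin. -/
def spin (b : Bool) : ℝ := if b then 1 else -1

def east (L : ℕ) : Site L := (1, 0)
def north (L : ℕ) : Site L := (0, 1)

variable {L : ℕ}

/-- `S_σ(x)`: the sum of the spins of the four nearest neighbours of `x`. -/
def nnS (σ : Config L) (x : Site L) : ℝ :=
  spin (σ (x + east L)) + spin (σ (x - east L)) +
    spin (σ (x + north L)) + spin (σ (x - north L))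

/-- Single-site heat-bath probability `p_x(a|σ)`. -/
def flipP (β h : ℝ) (σ : Config L) (x : Site L) (a : Bool) : ℝ :=
  1 / (1 + Real.exp (-2 * β * spin a * (nnS σ x + h)))

/-- The PCA transition matrix `P(σ,η) = ∏_x p_x(η(x)|σ)`. -/
def Pmat (β h : ℝ) [NeZero L] (σ η : Config L) : ℝ :=
  ∏ x : Site L, flipP β h σ x (η x)

/-- The four-body Hamiltonian `H_β`. -/
def Ham (β h : ℝ) [NeZero L] (σ : Config L) : ℝ :=
  -(β * h) * ∑ x : Site L, spin (σ x)
    - ∑ x : Site L, Real.log (Real.cosh (β * (nnS σ x + h)))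

/-- The zero-temperature energy `E`. -/
def En (h : ℝ) [NeZero L] (σ : Config L) : ℝ :=
  -h * ∑ x : Site L, spin (σ x) - ∑ x : Site L, |nnS σ x + h|

/-- The zero-temperature drift map `T`. -/
def T (h : ℝ) (σ : Config L) : Config L :=
  fun x => if 0 < nnS σ x + h then true else false

def plusC (L : ℕ) : Config L := fun _ => true
def minusC (L : ℕ) : Config L := fun _ => false

/-- The even chessboard `C_e(x) = (-1)^(x₁+x₂)` (`true` at even-parity sites). -/
def chessE (L : ℕ) : Config L := fun x => decide ((x.1 + x.2).val % 2 = 0)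
def chessO (L : ℕ) : Config L := fun x => !(chessE L x)
def chessSet (L : ℕ) : Set (Config L) := {chessE L, chessO L}

def IsChessCfg {L : ℕ} (C : Config L) : Prop := C = chessE L ∨ C = chessO L

/-- A trap: a stable configuration or an element of a stable pair. -/
def IsTrap (h : ℝ) (σ : Config L) : Prop := T h σ = σ ∨ T h (T h σ) = σ

/-- The trap `σ̂` reached by the downhill path started at `σ`. -/
def hatTrap (h : ℝ) (σ : Config L) : Config L :=
  (T h)^[sInf {n | IsTrap h ((T h)^[n] σ)}] σ

/-- The basin of attraction `𝔅(ζ)` of a trap `ζ`. -/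
def basin (h : ℝ) (ζ : Config L) : Set (Config L) := {σ | hatTrap h σ = ζ}

/-- The interior of a rectangle on the dual lattice: an `a × b` block of sites
with lower-left corner `c`. -/
def rect (c : Site L) (a b : ℕ) : Set (Site L) :=
  { y | ∃ i j : ℕ, i < a ∧ j < b ∧ y = c + ((i : ZMod L), (j : ZMod L)) }

/-- The configuration equal to `ζ` inside the given rectangle and to `bg` outside. -/
def rectCfg (bg ζ : Config L) (c : Site L) (a b : ℕ) : Config L :=
  fun x => if x ∈ rect c a b then ζ x else bg x

/-- Differences between sites at euclidean distance at most `2` on the torus. -/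
def closeDiff (d : Site L) : Prop :=
  ∃ u v : ℤ, u ^ 2 + v ^ 2 ≤ 4 ∧ d = ((u : ZMod L), (v : ZMod L))

/-- Two sets of sites are non-interacting iff all pairs of sites are at
euclidean distance `> 2` (equivalently `≥ √5`). -/
def NonInteracting (A B : Set (Site L)) : Prop :=
  ∀ x ∈ A, ∀ y ∈ B, ¬ closeDiff (y - x)

/-- Nearest-neighbour adjacency on the torus. -/
def Adj (x y : Site L) : Prop :=
  y = x + east L ∨ y = x - east L ∨ y = x + north L ∨ y = x - north L

def stepSet : Set (ℤ × ℤ) := {(1, 0), (-1, 0), (0, 1), (0, -1)}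

/-- `X` contains a nearest-neighbour loop winding around the torus
(a percolating, torus-wrapping, cluster is a cluster containing such a loop). -/
def Wrapping (X : Set (Site L)) : Prop :=
  ∃ (n : ℕ) (f : ℕ → Site L) (d : ℕ → ℤ × ℤ),
    0 < n ∧ f n = f 0 ∧ (∑ i ∈ Finset.range n, d i) ≠ 0 ∧
    ∀ i < n, d i ∈ stepSet ∧
      f (i + 1) = f i + (((d i).1 : ZMod L), ((d i).2 : ZMod L)) ∧ f i ∈ X

/-- `σ` has a well defined sea of the homogeneous phase `α`. -/
def SeaHom (h : ℝ) (α σ : Config L) : Prop :=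
  ∃ X : Set (Site L), Wrapping X ∧ (∀ x ∈ X, σ x = α x) ∧
    ∀ n : ℕ, 1 ≤ n → ∀ x ∈ X, (T h)^[n] σ x = α x

/-- `σ` has a well defined sea of the chessboard `C`. -/
def SeaChess (h : ℝ) (C σ : Config L) : Prop :=
  ∃ X : Set (Site L), Wrapping X ∧ (∀ x ∈ X, σ x = C x) ∧
    ∀ n : ℕ, 1 ≤ n → ∀ x ∈ X, (T h)^[2 * n] σ x = C x

def SeaMinus (h : ℝ) (σ : Config L) : Prop := SeaHom h (minusC L) σ
def SeaPlus (h : ℝ) (σ : Config L) : Prop := SeaHom h (plusC L) σ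
def SeaChessAny (h : ℝ) (σ : Config L) : Prop :=
  SeaChess h (chessE L) σ ∨ SeaChess h (chessO L) σ

/-- Communication height `H(σ,η) = H(σ) - log P(σ,η)`. -/
def commH (β h : ℝ) [NeZero L] (σ η : Config L) : ℝ :=
  Ham β h σ - Real.log (Pmat β h σ η)

/-- Minimal height (minmax) `Φ(σ,η)` over all paths from `σ` to `η`. -/
def Phi (β h : ℝ) [NeZero L] (σ η : Config L) : ℝ :=
  sInf { v | ∃ (n : ℕ) (f : ℕ → Config L), 0 < n ∧ f 0 = σ ∧ f n = η ∧
    v = sSup { w | ∃ i < n, w = commH β h (f i) (f (i + 1)) } }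

/-- The barrier `Υ(η) = min_{ζ ∉ 𝔅(η)} Φ(η,ζ)` to exit the basin of the trap `η`. -/
def Ups (β h : ℝ) [NeZero L] (η : Config L) : ℝ :=
  sInf { v | ∃ ζ : Config L, ζ ∉ basin h η ∧ v = Phi β h η ζ }

/-- Probability, starting from `σ0`, that the first visit to `E` happens
at time `n` and at a state of `F`. -/
def firstHitP (β h : ℝ) [NeZero L] (σ0 : Config L) (E F : Set (Config L)) (n : ℕ) : ℝ :=
  ∑ f : Fin (n + 1) → Config L,
    if f 0 = σ0 ∧ (∀ i : Fin (n + 1), (i : ℕ) < n → f i ∉ E) ∧ f (Fin.last n) ∈ E ∩ F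
    then ∏ i : Fin n, Pmat β h (f i.castSucc) (f i.succ) else 0

/-- `ℙ_{σ0}(τ_A < τ_B)`. -/
def probHitBefore (β h : ℝ) [NeZero L] (σ0 : Config L) (A B : Set (Config L)) : ℝ :=
  ∑' n : ℕ, firstHitP β h σ0 (A ∪ B) (A \ B) n

/-- `ℙ_{σ0}(τ_D ∈ I)` (for `τ_D < ∞`). -/
def probTauIn (β h : ℝ) [NeZero L] (σ0 : Config L) (D : Set (Config L)) (I : Set ℝ) : ℝ :=
  ∑' n : ℕ, if (n : ℝ) ∈ I then firstHitP β h σ0 D Set.univ n else 0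

/-- `ℙ_{σ0}(τ_D > t)` (including the event that `D` is never visited). -/
def probTauGT (β h : ℝ) [NeZero L] (σ0 : Config L) (D : Set (Config L)) (t : ℝ) : ℝ :=
  1 - probTauIn β h σ0 D (Set.Iic t)

/-- `ℙ_{σ0}(σ_{τ_E} ∈ F)`. -/
def probFirstHitIn (β h : ℝ) [NeZero L] (σ0 : Config L) (E F : Set (Config L)) : ℝ :=
  ∑' n : ℕ, firstHitP β h σ0 E F n

/-- The critical length `λ = ⌊2/h⌋ + 1`. -/
def lam (h : ℝ) : ℕ := Nat.floor (2 / h) + 1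

/-- The protocritical height `Γ = -2hλ² + 2λ(4+h) - 2h`. -/
def Gam (h : ℝ) : ℝ :=
  -2 * h * (lam h : ℝ) ^ 2 + 2 * (lam h : ℝ) * (4 + h) - 2 * h

/-- The geometric conditions of Proposition 3.3 (iii) for a trap in the sea of
minuses, with `s` chessboard rectangles (indices `< s`) and `k - s` plus
rectangles (indices `≥ s`). -/
def MinusMultiSpec (h : ℝ) (σ : Config L) (s : ℕ) {k : ℕ}
    (c : Fin k → Site L) (a b : Fin k → ℕ) : Prop :=
  1 ≤ k ∧ s ≤ k ∧
  (∀ i, 2 ≤ min (a i) (b i) ∧ max (a i) (b i) ≤ L - 2) ∧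
  (∀ i j, i ≠ j → Disjoint (rect (c i) (a i) (b i)) (rect (c j) (a j) (b j))) ∧
  (∀ j i : Fin k, (j : ℕ) < s → s ≤ (i : ℕ) →
    NonInteracting (rect (c j) (a j) (b j)) (rect (c i) (a i) (b i))) ∧
  (∀ i j : Fin k, s ≤ (i : ℕ) → s ≤ (j : ℕ) → i ≠ j →
    NonInteracting (rect (c i) (a i) (b i)) (rect (c j) (a j) (b j))) ∧
  (∀ x, (∀ i, x ∉ rect (c i) (a i) (b i)) → σ x = false) ∧
  (∀ i : Fin k, s ≤ (i : ℕ) → ∀ x ∈ rect (c i) (a i) (b i), σ x = true) ∧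
  ∃ Cp : Fin k → Config L,
    (∀ j : Fin k, (j : ℕ) < s → IsChessCfg (Cp j) ∧
      ∃ (k' : ℕ) (c' : Fin k' → Site L) (a' b' : Fin k' → ℕ),
        (∀ i, rect (c' i) (a' i) (b' i) ⊆ rect (c j) (a j) (b j)) ∧
        (∀ i i', i ≠ i' →
          NonInteracting (rect (c' i) (a' i) (b' i)) (rect (c' i') (a' i') (b' i'))) ∧
        (∀ i, ∀ x ∈ rect (c' i) (a' i) (b' i), σ x = true) ∧
        (∀ x ∈ rect (c j) (a j) (b j),
          (∀ i, x ∉ rect (c' i) (a' i) (b' i)) → σ x = Cp j x)) ∧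
    (∀ i j : Fin k, (i : ℕ) < s → (j : ℕ) < s → i ≠ j → Cp i = Cp j →
      NonInteracting (rect (c i) (a i) (b i)) (rect (c j) (a j) (b j)))

/-- `η ∈ 𝒪_{-1}` (a `(λ-1) × λ` chessboard droplet in the sea of minuses) and
`ζ ∈ π_{-1}(η)` is one of its protocritical droplets. -/
def ProtoRel (h : ℝ) (η ζ : Config L) : Prop :=
  ∃ (c : Site L) (a b : ℕ) (C : Config L) (y z : Site L),
    IsChessCfg C ∧
    ((a = lam h - 1 ∧ b = lam h) ∨ (a = lam h ∧ b = lam h - 1)) ∧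
    (∀ x ∈ rect c a b, η x = C x) ∧ (∀ x ∉ rect c a b, η x = false) ∧
    y ∉ rect c a b ∧ z ∈ rect c a b ∧ Adj y z ∧ C z = true ∧
    (∀ x ∈ rect c a b, ζ x = !(C x)) ∧ ζ y = true ∧
    (∀ x, x ∉ rect c a b → x ≠ y → ζ x = false)

/-- The set `𝒪_{-1}` of `(λ-1) × λ` chessboard droplets in the sea of minuses. -/
def OSet (h : ℝ) (L : ℕ) : Set (Config L) :=
  { η | ∃ (c : Site L) (a b : ℕ) (C : Config L),
      IsChessCfg C ∧ ((a = lam h - 1 ∧ b = lam h) ∨ (a = lam h ∧ b = lam h - 1)) ∧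
      (∀ x ∈ rect c a b, η x = C x) ∧ (∀ x ∉ rect c a b, η x = false) }

/-- The set `𝒫_{-1}` of protocritical droplets. -/
def ProtoSet (h : ℝ) (L : ℕ) : Set (Config L) := { ζ | ∃ η, ProtoRel h η ζ }

end

section Chain

variable {V : Type*} [Fintype V]

/-- `P` is a stochastic matrix on the finite set `V`. -/
structure IsStoch (P : V → V → ℝ) : Prop where
  nonneg : ∀ x y, 0 ≤ P x y
  sum_one : ∀ x, ∑ y, P x y = 1

/-- The law at time `n` of the chain started at `x₀` and killed after its first visit to `E`:
the probability of being at a given state at time `n` without a visit to `E` before `n`. -/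
noncomputable def killedLaw (P : V → V → ℝ) (E : Set V) (x₀ : V) : ℕ → V → ℝ
  | 0 => fun x => if x = x₀ then 1 else 0
  | n + 1 => fun y => ∑ x, if x ∈ E then 0 else killedLaw P E x₀ n x * P x y

variable {P : V → V → ℝ}

lemma killedLaw_nonneg (hP : IsStoch P) (E : Set V) (x₀ : V) (n : ℕ) (x : V) :
    0 ≤ killedLaw P E x₀ n x := by
  induction n generalizing x with
  | zero => simp only [killedLaw]; split_ifs <;> norm_num
  | succ n ih =>
    simp only [killedLaw]
    refine Finset.sum_nonneg fun y _ => ?_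
    split_ifs
    · exact le_rfl
    · exact mul_nonneg (ih y) (hP.nonneg y x)

/-- Minimum principle. -/
lemma IsStoch.min_principle (hP : IsStoch P) {W : Set V}
    (hW : ∀ x ∈ W, ∃ z, z ∉ W ∧ 0 < P x z) {φ : V → ℝ} (h0 : ∀ x, x ∉ W → 0 ≤ φ x)
    (hs : ∀ x ∈ W, ∑ y, P x y * φ y ≤ φ x) (x : V) : 0 ≤ φ x := by
  have : Nonempty V := ⟨x⟩
  obtain ⟨m, hm⟩ := Finite.exists_min φ
  refine le_trans ?_ (hm x)
  by_contra hneg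
  push Not at hneg
  have hmW : m ∈ W := by
    by_contra h
    exact absurd (h0 m h) (not_le.mpr hneg)
  obtain ⟨z, hz, hpz⟩ := hW m hmW
  have h1 : ∑ y, P m y * (φ y - φ m) ≤ 0 := by
    simp only [mul_sub, Finset.sum_sub_distrib, ← Finset.sum_mul, hP.sum_one]
    linarith [hs m hmW]
  have h2 : P m z * (φ z - φ m) ≤ ∑ y, P m y * (φ y - φ m) :=
    Finset.single_le_sum (f := fun y => P m y * (φ y - φ m))
      (fun y _ => mul_nonneg (hP.nonneg m y) (sub_nonneg.mpr (hm y))) (Finset.mem_univ z)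
  have h3 : 0 < P m z * (φ z - φ m) := mul_pos hpz (by linarith [h0 z hz])
  linarith

/-- Solvability of the Dirichlet problem on `W`. -/
lemma IsStoch.exists_dirichlet (hP : IsStoch P) {W : Set V}
    (hW : ∀ x ∈ W, ∃ z, z ∉ W ∧ 0 < P x z) (r : V → ℝ) :
    ∃ φ : V → ℝ, ∀ x, φ x = r x + if x ∈ W then ∑ y, P x y * φ y else 0 := by
  let A : (V → ℝ) →ₗ[ℝ] (V → ℝ) :=
    { toFun := fun φ x => φ x - if x ∈ W then ∑ y, P x y * φ y else 0
      map_add' := by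
        intro f g; ext x
        simp only [Pi.add_apply, mul_add, Finset.sum_add_distrib]
        split_ifs <;> ring
      map_smul' := by
        intro c f; ext x
        simp only [Pi.smul_apply, smul_eq_mul, RingHom.id_apply]
        split_ifs
        · rw [mul_sub, Finset.mul_sum]
          congr 1
          exact Finset.sum_congr rfl fun y _ => by ring
        · ring }
  have hinj : Function.Injective A := by
    rw [← LinearMap.ker_eq_bot, LinearMap.ker_eq_bot']
    intro φ hφ
    have key : ∀ x, φ x = if x ∈ W then ∑ y, P x y * φ y else 0 := fun x =>
      sub_eq_zero.mp (congrFun hφ x)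
    have hle : ∀ x, 0 ≤ φ x := hP.min_principle hW
      (fun x hx => by rw [key x, if_neg hx])
      (fun x hx => by conv_rhs => rw [key x, if_pos hx])
    have hge : ∀ x, 0 ≤ -φ x := hP.min_principle hW (φ := fun x => -φ x)
      (fun x hx => by rw [key x, if_neg hx, neg_zero])
      (fun x hx => by
        simp only [mul_neg, Finset.sum_neg_distrib]
        conv_rhs => rw [key x, if_pos hx])
    ext x
    exact le_antisymm (neg_nonneg.mp (hge x)) (hle x)
  obtain ⟨φ, hφ⟩ := (LinearMap.injective_iff_surjective.mp hinj) r
  exact ⟨φ, fun x => by rw [← congrFun hφ x]; simp [A]⟩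

lemma killedLaw_succ_sum (E : Set V) (x₀ : V) (n : ℕ) (φ : V → ℝ) :
    ∑ y, killedLaw P E x₀ (n + 1) y * φ y =
      ∑ x, killedLaw P E x₀ n x * (if x ∈ E then 0 else ∑ y, P x y * φ y) := by
  simp only [killedLaw, Finset.sum_mul]
  rw [Finset.sum_comm]
  refine Finset.sum_congr rfl fun x _ => ?_
  split_ifs
  · simp
  · rw [Finset.mul_sum]
    exact Finset.sum_congr rfl fun y _ => by ring

lemma killedLaw_zero_sum (E : Set V) (x₀ : V) (φ : V → ℝ) :
    ∑ y, killedLaw P E x₀ 0 y * φ y = φ x₀ := by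
  simp [killedLaw]

/-- Supersolutions bound the expected reward collected up to the first visit to `E`. -/
lemma killedLaw_sum_le (hP : IsStoch P) (E : Set V) (x₀ : V) {φ r : V → ℝ}
    (h : ∀ x, r x + (if x ∈ E then 0 else ∑ y, P x y * φ y) ≤ φ x) (N : ℕ) :
    ∑ n ∈ Finset.range N, ∑ x, killedLaw P E x₀ n x * r x + ∑ x, killedLaw P E x₀ N x * φ x
      ≤ φ x₀ := by
  induction N with
  | zero => simp [killedLaw_zero_sum]
  | succ N ih =>
    refine le_trans ?_ ih
    rw [Finset.sum_range_succ, killedLaw_succ_sum, add_assoc, ← Finset.sum_add_distrib]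
    gcongr with x
    rw [← mul_add]
    exact mul_le_mul_of_nonneg_left (h x) (killedLaw_nonneg hP E x₀ N x)

lemma killedLaw_sum_eq (E : Set V) (x₀ : V) {φ r : V → ℝ}
    (h : ∀ x, φ x = r x + (if x ∈ E then 0 else ∑ y, P x y * φ y)) (N : ℕ) :
    ∑ n ∈ Finset.range N, ∑ x, killedLaw P E x₀ n x * r x + ∑ x, killedLaw P E x₀ N x * φ x
      = φ x₀ := by
  induction N with
  | zero => simp [killedLaw_zero_sum]
  | succ N ih =>
    rw [← ih, Finset.sum_range_succ, killedLaw_succ_sum, add_assoc, ← Finset.sum_add_distrib]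
    congr 1
    exact Finset.sum_congr rfl fun x _ => by rw [← mul_add, ← h x]

/-- When `P` is positive and `E` is nonempty, the survival probability vanishes. -/
lemma killedLaw_survival (hP : IsStoch P) (hpos : ∀ x y, 0 < P x y) {E : Set V}
    (hE : E.Nonempty) (x₀ : V) :
    Tendsto (fun n => ∑ x, killedLaw P E x₀ n x) atTop (nhds 0) := by
  obtain ⟨e, he⟩ := hE
  have : Nonempty V := ⟨e⟩
  obtain ⟨m, hm⟩ := Finite.exists_min (fun x => P x e)
  set p := P m e with hp
  have hp0 : 0 < p := hpos m e
  have hp1 : p ≤ 1 := by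
    rw [hp, ← hP.sum_one m]
    exact Finset.single_le_sum (f := fun y => P m y) (fun y _ => hP.nonneg m y)
      (Finset.mem_univ e)
  set v := fun n => ∑ x, killedLaw P E x₀ n x * (if x ∈ E then 0 else 1) with hv
  have hstep : ∀ n, v (n + 1) ≤ (1 - p) * v n := by
    intro n
    simp only [hv]
    rw [killedLaw_succ_sum, Finset.mul_sum]
    refine Finset.sum_le_sum fun x _ => ?_
    have h0 := killedLaw_nonneg hP E x₀ n x
    by_cases hx : x ∈ E
    · simp [hx]
    · simp only [hx, if_false, mul_one]
      rw [mul_comm]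
      refine mul_le_mul_of_nonneg_right ?_ h0
      have h1 : ∑ y, P x y * (if y ∈ E then (0 : ℝ) else 1) + P x e ≤ ∑ y, P x y := by
        have h2 : P x e ≤ ∑ y, P x y * (if y ∈ E then (1 : ℝ) else 0) := by
          have := Finset.single_le_sum (f := fun y => P x y * (if y ∈ E then (1 : ℝ) else 0))
            (fun y _ => mul_nonneg (hP.nonneg x y) (by split_ifs <;> norm_num))
            (Finset.mem_univ e)
          simpa [he] using this
        calc _ ≤ ∑ y, P x y * (if y ∈ E then (0 : ℝ) else 1) +
              ∑ y, P x y * (if y ∈ E then (1 : ℝ) else 0) := by gcongr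
          _ = _ := by
            rw [← Finset.sum_add_distrib]
            refine Finset.sum_congr rfl fun y _ => ?_
            split_ifs <;> ring
      rw [hP.sum_one] at h1
      linarith [hm x]
  have hv0 : ∀ n, 0 ≤ v n := fun n => Finset.sum_nonneg fun x _ =>
    mul_nonneg (killedLaw_nonneg hP E x₀ n x) (by split_ifs <;> norm_num)
  have hgeo : ∀ n, v n ≤ (1 - p) ^ n * v 0 := by
    intro n
    induction n with
    | zero => simp
    | succ n ih =>
      calc v (n + 1) ≤ (1 - p) * v n := hstep n
        _ ≤ (1 - p) * ((1 - p) ^ n * v 0) := by gcongr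
        _ = _ := by ring
  have hvt : Tendsto v atTop (nhds 0) := by
    refine squeeze_zero hv0 hgeo ?_
    simpa using (tendsto_pow_atTop_nhds_zero_of_lt_one (by linarith : (0 : ℝ) ≤ 1 - p)
      (by linarith : 1 - p < 1)).mul_const (v 0)
  rw [← tendsto_add_atTop_iff_nat 1]
  refine hvt.congr fun n => ?_
  have := killedLaw_succ_sum (P := P) E x₀ n (fun _ => 1)
  simp only [mul_one, hP.sum_one] at this
  rw [this]

end Chain

lemma exists_variation_bound {V : Type*} {r : V → V → Prop} {a b : V} (h : Relation.ReflTransGen r a b) :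
    ∃ n : ℕ, ∀ (f : V → ℝ) (d : ℝ), (∀ x y, r x y → |f x - f y| ≤ d) → |f a - f b| ≤ n * d := by
  induction h with
  | refl => exact ⟨0, fun f d _ => by simp⟩
  | @tail b c _ hbc ih =>
    obtain ⟨n, hn⟩ := ih
    refine ⟨n + 1, fun f d hd => ?_⟩
    calc |f a - f c| ≤ |f a - f b| + |f b - f c| := abs_sub_le _ _ _
      _ ≤ n * d + d := add_le_add (hn f d hd) (hd b c hbc)
      _ = _ := by push_cast; ring

lemma exists_exit_bound {V : Type*} {r : V → V → Prop} {W Q : Set V} {a p : V} (ha : a ∈ W)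
    (hW : ∀ x ∈ W, ∀ y, r x y → y ∈ W ∪ Q) (hp : p ∉ W) (h : Relation.ReflTransGen r a p) :
    ∃ n : ℕ, ∀ (f : V → ℝ) (d : ℝ), (∀ x ∈ Q, f x = 0) →
      (∀ x ∈ W, ∀ y ∈ W ∪ Q, r x y → |f x - f y| ≤ d) → |f a| ≤ n * d := by
  have key : ∀ x, Relation.ReflTransGen r a x →
      (x ∈ W ∧ Relation.ReflTransGen (fun x y => x ∈ W ∧ y ∈ W ∪ Q ∧ r x y) a x) ∨
      ∃ q ∈ Q, Relation.ReflTransGen (fun x y => x ∈ W ∧ y ∈ W ∪ Q ∧ r x y) a q := by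
    intro x hx
    induction hx with
    | refl => exact Or.inl ⟨ha, .refl⟩
    | @tail b c _ hbc ih =>
      rcases ih with ⟨hbW, hb⟩ | hq
      · have hc := hW b hbW c hbc
        have hac := hb.tail ⟨hbW, hc, hbc⟩
        rcases hc with hc | hc
        · exact Or.inl ⟨hc, hac⟩
        · exact Or.inr ⟨c, hc, hac⟩
      · exact Or.inr hq
  rcases key p h with ⟨hpW, _⟩ | ⟨q, hq, haq⟩
  · exact absurd hpW hp
  obtain ⟨n, hn⟩ := exists_variation_bound haq
  refine ⟨n, fun f d hfQ hd => ?_⟩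
  have := hn f d fun x y hxy => hd x hxy.1 y hxy.2.1 hxy.2.2
  rwa [hfQ q hq, sub_zero] at this

section Reversible

variable {V : Type*} [Fintype V]

/-- Reversibility: the weights `π x * P x y` are symmetric conductances `c x y`. -/
structure IsRev (P : V → V → ℝ) (π : V → ℝ) (c : V → V → ℝ) : Prop where
  stoch : IsStoch P
  pos : ∀ x, 0 < π x
  cond : ∀ x y, π x * P x y = c x y
  symm : ∀ x y, c x y = c y x

variable {P : V → V → ℝ} {π : V → ℝ} {c : V → V → ℝ}

lemma IsRev.cond_nonneg (hR : IsRev P π c) (x y : V) : 0 ≤ c x y := by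
  rw [← hR.cond]
  exact mul_nonneg (hR.pos x).le (hR.stoch.nonneg x y)

lemma IsRev.sum_cond (hR : IsRev P π c) (x : V) : ∑ y, c x y = π x := by
  simp only [← hR.cond, ← Finset.mul_sum, hR.stoch.sum_one, mul_one]

lemma IsRev.sum_cond_sub (hR : IsRev P π c) (f : V → ℝ) (x : V) :
    ∑ y, c x y * (f x - f y) = π x * (f x - ∑ y, P x y * f y) := by
  simp only [mul_sub, Finset.sum_sub_distrib, ← Finset.sum_mul, hR.sum_cond, Finset.mul_sum,
    ← mul_assoc, hR.cond]

/-- Green identity. -/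
lemma sum_sum_symm (hsymm : ∀ x y, c x y = c y x) (f : V → ℝ) :
    ∑ x, ∑ y, c x y * (f x - f y) ^ 2 = 2 * ∑ x, f x * ∑ y, c x y * (f x - f y) := by
  have h : ∑ x, f x * ∑ y, c x y * (f x - f y) = ∑ x, ∑ y, c x y * (f y * (f y - f x)) := by
    rw [Finset.sum_comm]
    refine Finset.sum_congr rfl fun x _ => ?_
    rw [Finset.mul_sum]
    exact Finset.sum_congr rfl fun y _ => by rw [hsymm]; ring
  rw [two_mul]
  conv_rhs => arg 2; rw [h]
  rw [← Finset.sum_add_distrib]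
  refine Finset.sum_congr rfl fun x _ => ?_
  rw [Finset.mul_sum, ← Finset.sum_add_distrib]
  exact Finset.sum_congr rfl fun y _ => by ring

/-- The energy of a function bounds its variation along each edge. -/
lemma edge_le_of_energy (hsymm : ∀ x y, c x y = c y x) (hc : ∀ x y, 0 ≤ c x y) (f : V → ℝ)
    (x y : V) : c x y * (f x - f y) ^ 2 ≤ ∑ x, f x * ∑ y, c x y * (f x - f y) := by
  have hnn : ∀ x y, 0 ≤ c x y * (f x - f y) ^ 2 := fun x y => mul_nonneg (hc x y) (sq_nonneg _)
  have hrow : ∀ x y, c x y * (f x - f y) ^ 2 ≤ ∑ y, c x y * (f x - f y) ^ 2 := fun x y =>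
    Finset.single_le_sum (f := fun y => c x y * (f x - f y) ^ 2) (fun y _ => hnn x y)
      (Finset.mem_univ y)
  have hrn : ∀ x, 0 ≤ ∑ y, c x y * (f x - f y) ^ 2 := fun x => Finset.sum_nonneg fun y _ => hnn x y
  have h2 := sum_sum_symm hsymm f
  rcases eq_or_ne x y with rfl | hxy
  · have := Finset.sum_nonneg fun x (_ : x ∈ Finset.univ) => hrn x
    simp only [sub_self]
    linarith
  · have h3 : ∑ z ∈ {x, y}, ∑ w, c z w * (f z - f w) ^ 2 ≤ ∑ z, ∑ w, c z w * (f z - f w) ^ 2 :=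
      Finset.sum_le_sum_of_subset_of_nonneg (Finset.subset_univ _) fun z _ _ => hrn z
    rw [Finset.sum_pair hxy] at h3
    have h4 := hrow y x
    rw [hsymm y x] at h4
    nlinarith [hrow x y]

/-- Edge bound for the Green function of a reversible chain killed on `E`. -/
lemma IsRev.green_edge (hR : IsRev P π c) {E : Set V} {t : V} (ht : t ∉ E) {g : V → ℝ}
    (hg : ∀ x, g x = (if x = t then 1 else 0) + if x ∈ Eᶜ then ∑ y, P x y * g y else 0) (x y : V) :
    c x y * (g x - g y) ^ 2 ≤ π t * g t := by
  refine (edge_le_of_energy hR.symm hR.cond_nonneg g x y).trans_eq ?_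
  rw [Finset.sum_eq_single t]
  · rw [hR.sum_cond_sub]
    have h := hg t
    rw [if_pos rfl, if_pos (show t ∈ Eᶜ from ht)] at h
    have h' : g t - ∑ y, P t y * g y = 1 := by linarith
    rw [h']; ring
  · intro x _ hx
    rw [hR.sum_cond_sub]
    by_cases hxE : x ∈ E
    · have h := hg x
      rw [if_neg hx, if_neg (by simpa using hxE)] at h
      rw [h]; ring
    · have h := hg x
      rw [if_neg hx, if_pos (show x ∈ Eᶜ from hxE), zero_add] at h
      rw [← h]; ring
  · intro h; exact absurd (Finset.mem_univ t) h

/-- Edge bound for a function harmonic on `W`, vanishing on `Q` and bounded by `1`. -/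
lemma IsRev.exit_edge (hR : IsRev P π c) {W Q : Set V} {f : V → ℝ}
    (hf0 : ∀ x, 0 ≤ f x) (hf1 : ∀ x, f x ≤ 1) (hQ : ∀ x ∈ Q, f x = 0)
    (hWf : ∀ x ∈ W, f x = ∑ y, P x y * f y) {ε : ℝ}
    (hε : ∑ x, ∑ y, (if x ∈ W ∧ y ∉ W ∧ y ∉ Q then c x y else 0) ≤ ε)
    {x y : V} (hx : x ∈ W) (hy : y ∈ W ∪ Q) :
    c x y * (f x - f y) ^ 2 ≤ 2 * ε := by
  set c' : V → V → ℝ := fun x y =>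
    if (x ∈ W ∧ y ∈ W) ∨ (x ∈ W ∧ y ∈ Q) ∨ (x ∈ Q ∧ y ∈ W) then c x y else 0 with hc'
  have hsymm : ∀ x y, c' x y = c' y x := by
    intro x y
    simp only [hc', hR.symm x y]
    congr 1
    apply propext
    tauto
  have hnn : ∀ x y, 0 ≤ c' x y := by
    intro x y
    simp only [hc']
    split_ifs
    · exact hR.cond_nonneg x y
    · exact le_rfl
  have hedge := edge_le_of_energy hsymm hnn f x y
  have hxy : c' x y = c x y := by
    simp only [hc']
    rw [if_pos]
    rcases hy with hy | hy
    · exact Or.inl ⟨hx, hy⟩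
    · exact Or.inr (Or.inl ⟨hx, hy⟩)
  rw [hxy] at hedge
  refine hedge.trans ?_
  have hε0 : 0 ≤ ∑ x, ∑ y, (if x ∈ W ∧ y ∉ W ∧ y ∉ Q then c x y else 0) := by
    refine Finset.sum_nonneg fun x _ => Finset.sum_nonneg fun y _ => ?_
    split_ifs
    · exact hR.cond_nonneg x y
    · exact le_rfl
  suffices h : ∑ x, f x * ∑ y, c' x y * (f x - f y) ≤
      ∑ x, ∑ y, (if x ∈ W ∧ y ∉ W ∧ y ∉ Q then c x y else 0) by linarith
  refine Finset.sum_le_sum fun x _ => ?_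
  by_cases hxW : x ∈ W
  · have h0 : ∑ y, c x y * (f x - f y) = 0 := by
      rw [hR.sum_cond_sub, ← hWf x hxW]; ring
    have h1 : f x * ∑ y, c' x y * (f x - f y) = ∑ y, f x * ((c' x y - c x y) * (f x - f y)) := by
      rw [← Finset.mul_sum]
      congr 1
      simp only [sub_mul, Finset.sum_sub_distrib]
      rw [h0, sub_zero]
    rw [h1]
    refine Finset.sum_le_sum fun y _ => ?_
    have hcn := hR.cond_nonneg x y
    by_cases hy : y ∈ W ∨ y ∈ Q
    · have : c' x y = c x y := by
        simp only [hc']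
        rw [if_pos]; tauto
      rw [this, sub_self, zero_mul, mul_zero]
      split_ifs <;> simp [hcn]
    · push Not at hy
      have h3 : c' x y = 0 := by
        simp only [hc']
        rw [if_neg]; tauto
      rw [h3, if_pos ⟨hxW, hy.1, hy.2⟩]
      have hfx := hf0 x
      have hfy := hf0 y
      have : f x * f y ≤ 1 := mul_le_one₀ (hf1 x) hfy (hf1 y)
      nlinarith [mul_nonneg hcn (mul_nonneg hfx hfx), mul_le_mul_of_nonneg_left this hcn]
  · have : f x * ∑ y, c' x y * (f x - f y) = 0 := by
      by_cases hxQ : x ∈ Q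
      · rw [hQ x hxQ, zero_mul]
      · have : ∀ y, c' x y = 0 := by
          intro y
          simp only [hc']
          rw [if_neg]; tauto
        simp [this]
    rw [this]
    refine Finset.sum_nonneg fun y _ => ?_
    simp [hxW]

/-- By reversibility, the killed law is dominated by the
reversible measure. -/
lemma IsRev.killedLaw_le (hR : IsRev P π c) (E : Set V) (x₀ : V) (n : ℕ) (x : V) :
    killedLaw P E x₀ n x ≤ π x / π x₀ := by
  have hp := hR.pos
  induction n generalizing x with
  | zero =>
    simp only [killedLaw]
    split_ifs with h
    · rw [h, div_self (hp x₀).ne']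
    · exact (div_pos (hp x) (hp x₀)).le
  | succ n ih =>
    simp only [killedLaw]
    calc _ ≤ ∑ y, c x y / π x₀ := by
          refine Finset.sum_le_sum fun y _ => ?_
          split_ifs
          · exact div_nonneg (hR.cond_nonneg x y) (hp x₀).le
          · rw [hR.symm, ← hR.cond, mul_div_right_comm]
            exact mul_le_mul_of_nonneg_right (ih y) (hR.stoch.nonneg y x)
      _ = _ := by rw [← Finset.sum_div, hR.sum_cond]

/-- If all edges leaving the well `D` of `x₀` have conductance at most `ε`, then at each
time the probability of first hitting `E` at a given state is at most of order `ε`. -/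
lemma IsRev.killedLaw_flux (hR : IsRev P π c) {D E : Set V} {x₀ : V} (hx₀ : x₀ ∈ D)
    (hDE : ∀ x ∈ E, x ∉ D) {ε : ℝ} (hε : 0 ≤ ε) (hc : ∀ x ∈ D, ∀ y, y ∉ D → c x y ≤ ε)
    (hπ : 1 ≤ π x₀) (n : ℕ) {e : V} (he : e ∈ E) :
    killedLaw P E x₀ n e ≤ (Fintype.card V : ℝ) ^ 2 * ε := by
  let z : ℕ → V → ℝ := fun j => Nat.rec (fun x => if x = e then 1 else 0)
    (fun _ z x => if x ∈ D ∨ x ∈ E then 0 else ∑ y, P x y * z y) j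
  have hz0 : ∀ x, z 0 x = if x = e then 1 else 0 := fun x => rfl
  have hzs : ∀ j x, z (j + 1) x = if x ∈ D ∨ x ∈ E then 0 else ∑ y, P x y * z j y :=
    fun j x => rfl
  have hznn : ∀ j x, 0 ≤ z j x := by
    intro j
    induction j with
    | zero => intro x; rw [hz0]; split_ifs <;> norm_num
    | succ j ih =>
      intro x
      rw [hzs]
      split_ifs
      · exact le_rfl
      · exact Finset.sum_nonneg fun y _ => mul_nonneg (hR.stoch.nonneg x y) (ih y)
  have hzD : ∀ j, ∀ x ∈ D, z j x = 0 := by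
    intro j x hx
    cases j with
    | zero => rw [hz0, if_neg]; rintro rfl; exact hDE _ he hx
    | succ j => rw [hzs, if_pos (Or.inl hx)]
  have hzsum : ∀ J x, ∑ j ∈ Finset.range J, z j x ≤ 1 := by
    intro J
    induction J with
    | zero => intro x; simp
    | succ J ih =>
      intro x
      rw [Finset.sum_range_succ']
      by_cases hx : x ∈ D ∨ x ∈ E
      · simp only [hzs, if_pos hx, hz0, Finset.sum_const_zero, zero_add]
        split_ifs <;> norm_num
      · have hxe : x ≠ e := fun h => hx (Or.inr (h ▸ he))
        simp only [hzs, if_neg hx, hz0, if_neg hxe, add_zero]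
        rw [Finset.sum_comm]
        calc ∑ y, ∑ j ∈ Finset.range J, P x y * z j y
            = ∑ y, P x y * ∑ j ∈ Finset.range J, z j y := by simp only [Finset.mul_sum]
          _ ≤ ∑ y, P x y * 1 := by
            gcongr with y
            · exact hR.stoch.nonneg x y
            · exact ih y
          _ = 1 := by simp [hR.stoch.sum_one]
  set K : ℝ := Fintype.card V * ε with hK
  have hK0 : 0 ≤ K := by positivity
  have hstep : ∀ n j, ∑ x, killedLaw P E x₀ (n + 1) x * z j x ≤
      ∑ x, killedLaw P E x₀ n x * z (j + 1) x + ∑ x, K * z j x := by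
    intro n j
    rw [killedLaw_succ_sum]
    have h1 : ∀ x, killedLaw P E x₀ n x * (if x ∈ E then 0 else ∑ y, P x y * z j y) ≤
        killedLaw P E x₀ n x * z (j + 1) x + ∑ y, ε * z j y := by
      intro x
      have hs0 : 0 ≤ ∑ y, ε * z j y := Finset.sum_nonneg fun y _ => mul_nonneg hε (hznn j y)
      rw [hzs]
      by_cases hxE : x ∈ E
      · simpa [hxE] using hs0
      by_cases hxD : x ∈ D
      · rw [if_neg hxE, if_pos (Or.inl hxD), mul_zero, zero_add, Finset.mul_sum]
        refine Finset.sum_le_sum fun y _ => ?_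
        by_cases hyD : y ∈ D
        · rw [hzD j y hyD]; simp
        rw [← mul_assoc]
        refine mul_le_mul_of_nonneg_right ?_ (hznn j y)
        calc _ ≤ π x / π x₀ * P x y :=
              mul_le_mul_of_nonneg_right (hR.killedLaw_le E x₀ n x) (hR.stoch.nonneg x y)
          _ = c x y / π x₀ := by rw [← hR.cond]; ring
          _ ≤ c x y := div_le_self (hR.cond_nonneg x y) hπ
          _ ≤ ε := hc x hxD y hyD
      · rw [if_neg hxE, if_neg (by tauto)]
        linarith
    calc _ ≤ ∑ x, (killedLaw P E x₀ n x * z (j + 1) x + ∑ y, ε * z j y) :=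
          Finset.sum_le_sum fun x _ => h1 x
      _ = _ := by
        rw [Finset.sum_add_distrib]
        congr 1
        rw [Finset.sum_const, Finset.card_univ, nsmul_eq_mul, ← Finset.mul_sum, ← Finset.mul_sum,
          hK, mul_assoc]
  have htel : ∀ n j, ∑ x, killedLaw P E x₀ n x * z j x ≤
      ∑ i ∈ Finset.range n, ∑ x, K * z (j + i) x := by
    intro n
    induction n with
    | zero => intro j; simp [killedLaw_zero_sum, hzD j x₀ hx₀]
    | succ n ih =>
      intro j
      refine (hstep n j).trans ?_
      rw [Finset.sum_range_succ', add_zero]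
      gcongr
      refine (ih (j + 1)).trans_eq ?_
      refine Finset.sum_congr rfl fun i _ => ?_
      rw [add_right_comm, add_assoc]
  have h := htel n 0
  simp only [hz0, mul_ite, mul_one, mul_zero, Finset.sum_ite_eq', Finset.mem_univ, if_true,
    zero_add] at h
  refine h.trans ?_
  rw [Finset.sum_comm]
  calc _ = ∑ x, K * ∑ i ∈ Finset.range n, z i x := by simp only [Finset.mul_sum]
    _ ≤ ∑ _x : V, K * 1 := by gcongr; exact hzsum n _
    _ = _ := by simp [hK]; ring

end Reversible

lemma sum_paths_eq_killedLaw {V : Type*} [Fintype V] (P : V → V → ℝ) (E : Set V) (x₀ : V)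
    (n : ℕ) (g : V → ℝ) :
    ∑ f : Fin (n + 1) → V,
      (if f 0 = x₀ ∧ ∀ i : Fin (n + 1), (i : ℕ) < n → f i ∉ E then
        (∏ i : Fin n, P (f i.castSucc) (f i.succ)) * g (f (Fin.last n)) else 0) =
      ∑ x, killedLaw P E x₀ n x * g x := by
  induction n generalizing g with
  | zero =>
    rw [killedLaw_zero_sum, Fintype.sum_equiv (Equiv.funUnique (Fin 1) V) _
      (fun x => if x = x₀ then g x else 0)]
    · simp
    · intro f; simp
  | succ n ih =>
    rw [killedLaw_succ_sum, ← ih, Fintype.sum_equiv (Fin.snocEquiv fun _ => V).symm _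
      (fun p : V × (Fin (n + 1) → V) =>
        if p.2 0 = x₀ ∧ (∀ i : Fin (n + 1), p.2 i ∉ E) then
        (∏ i : Fin n, P (p.2 i.castSucc) (p.2 i.succ)) * P (p.2 (Fin.last n)) p.1 * g p.1 else 0)]
    · rw [Fintype.sum_prod_type, Finset.sum_comm]
      refine Finset.sum_congr rfl fun f _ => ?_
      by_cases hl : f (Fin.last n) ∈ E
      · simp only [hl, if_true, mul_zero, ite_self]
        refine Finset.sum_eq_zero fun y _ => if_neg ?_
        exact fun h => h.2 _ hl
      · have hiff : (∀ i : Fin (n + 1), f i ∉ E) ↔ ∀ i : Fin (n + 1), (i : ℕ) < n → f i ∉ E := by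
          refine ⟨fun h i _ => h i, fun h i => ?_⟩
          rcases lt_or_eq_of_le (Fin.le_last i) with h' | h'
          · exact h i h'
          · rwa [h']
        simp only [hiff, hl, if_false]
        split_ifs
        · rw [Finset.mul_sum]
          exact Finset.sum_congr rfl fun y _ => by ring
        · simp
    · intro f
      have hiff : (∀ i : Fin (n + 2), (i : ℕ) < n + 1 → f i ∉ E) ↔
          ∀ i : Fin (n + 1), f i.castSucc ∉ E := by
        constructor
        · intro h i
          exact h i.castSucc i.is_lt
        · intro h i hi
          exact h ⟨i, hi⟩
      simp only [hiff, Fin.snocEquiv, Equiv.coe_fn_symm_mk, Fin.init, Fin.prod_univ_castSucc]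
      rfl

section

variable {L : ℕ}

lemma flipP_pos (β h : ℝ) (σ : Config L) (x : Site L) (a : Bool) : 0 < flipP β h σ x a := by
  unfold flipP
  positivity

lemma flipP_add (β h : ℝ) (σ : Config L) (x : Site L) :
    flipP β h σ x true + flipP β h σ x false = 1 := by
  unfold flipP spin
  simp only [if_true, Bool.false_eq_true, if_false]
  set t := β * (nnS σ x + h)
  have e1 : -2 * β * 1 * (nnS σ x + h) = -(2 * t) := by ring
  have e2 : -2 * β * -1 * (nnS σ x + h) = 2 * t := by ring
  rw [e1, e2, Real.exp_neg]
  have := Real.exp_pos (2 * t)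
  field_simp
  ring

variable [NeZero L]

lemma firstHitP_eq (β h : ℝ) (σ₀ : Config L) (E F : Set (Config L)) (n : ℕ) :
    firstHitP β h σ₀ E F n =
      ∑ x, killedLaw (Pmat β h) E σ₀ n x * (if x ∈ E ∩ F then 1 else 0) := by
  rw [← sum_paths_eq_killedLaw]
  unfold firstHitP
  refine Finset.sum_congr rfl fun f _ => ?_
  by_cases h1 : f (Fin.last n) ∈ E ∩ F
  · simp only [h1, and_true, if_true, mul_one]
  · simp [h1]

lemma Pmat_pos (β h : ℝ) (σ η : Config L) : 0 < Pmat β h σ η :=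
  Finset.prod_pos fun x _ => flipP_pos β h σ x (η x)

lemma sum_prod_bool {ι : Type*} [Fintype ι] [DecidableEq ι] (g : ι → Bool → ℝ)
    (hg : ∀ i, g i true + g i false = 1) : ∑ η : ι → Bool, ∏ i, g i (η i) = 1 := by
  rw [← Fintype.prod_sum]
  simp [hg]

lemma isStoch_Pmat (β h : ℝ) : IsStoch (Pmat (L := L) β h) where
  nonneg σ η := (Pmat_pos β h σ η).le
  sum_one σ := by
    unfold Pmat
    exact sum_prod_bool (fun x a => flipP β h σ x a) fun x => flipP_add β h σ x

/-- A supersolution which is at least `1` on `B` controls the probability that the target `A`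
is not hit before `B`. -/
lemma one_sub_le_probHitBefore (β h : ℝ) (σ₀ : Config L) {A B : Set (Config L)}
    (hB : B.Nonempty) {φ : Config L → ℝ} (h0 : ∀ x, 0 ≤ φ x) (h1 : ∀ x ∈ B, 1 ≤ φ x)
    (hs : ∀ x, x ∉ A → x ∉ B → ∑ y, Pmat β h x y * φ y ≤ φ x) :
    1 - φ σ₀ ≤ probHitBefore β h σ₀ A B ∧ probHitBefore β h σ₀ A B ≤ 1 := by
  have hP := isStoch_Pmat (L := L) β h
  obtain ⟨E, hE⟩ : ∃ E, E = A ∪ B := ⟨_, rfl⟩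
  obtain ⟨F, hF⟩ : ∃ F, F = A \ B := ⟨_, rfl⟩
  have hEm : ∀ x, x ∈ E ↔ x ∈ A ∨ x ∈ B := fun x => by rw [hE]; rfl
  have hFm : ∀ x, x ∈ F ↔ x ∈ A ∧ x ∉ B := fun x => by rw [hF]; rfl
  have hEne : E.Nonempty := hB.mono fun x hx => (hEm x).2 (Or.inr hx)
  unfold probHitBefore
  rw [← hE, ← hF]
  set u := killedLaw (Pmat β h) E σ₀ with hu
  have hu0 : ∀ n x, 0 ≤ u n x := fun n x => killedLaw_nonneg hP E σ₀ n x
  set a : ℕ → ℝ := fun n => firstHitP β h σ₀ E F n with ha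
  have ha' : ∀ n, a n = ∑ x, u n x * (if x ∈ E ∩ F then 1 else 0) := fun n =>
    firstHitP_eq β h σ₀ E F n
  have ha0 : ∀ n, 0 ≤ a n := by
    intro n
    rw [ha']
    exact Finset.sum_nonneg fun x _ => mul_nonneg (hu0 n x) (by split_ifs <;> norm_num)
  have hb : ∀ N, ∑ n ∈ Finset.range N, ∑ x, u n x * (if x ∈ B then 1 else 0) ≤ φ σ₀ := by
    intro N
    refine le_trans ?_ (killedLaw_sum_le hP E σ₀ (φ := φ) (r := fun x => if x ∈ B then 1 else 0)
      (fun x => ?_) N)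
    · exact le_add_of_nonneg_right (Finset.sum_nonneg fun x _ => mul_nonneg (hu0 N x) (h0 x))
    · by_cases hxB : x ∈ B
      · have : x ∈ E := (hEm x).2 (Or.inr hxB)
        simpa [hxB, this] using h1 x hxB
      · by_cases hxA : x ∈ A
        · have : x ∈ E := (hEm x).2 (Or.inl hxA)
          simpa [hxB, this] using h0 x
        · have : x ∉ E := fun h => ((hEm x).1 h).elim hxA hxB
          simpa [hxB, this] using hs x hxA hxB
  have hsplit : ∀ x, (if x ∈ E then (1 : ℝ) else 0) =
      (if x ∈ E ∩ F then 1 else 0) + (if x ∈ B then 1 else 0) := by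
    intro x
    by_cases hxB : x ∈ B
    · have : x ∈ E := (hEm x).2 (Or.inr hxB)
      simp [hFm, hxB, this]
    · by_cases hxA : x ∈ A
      · have : x ∈ E := (hEm x).2 (Or.inl hxA)
        simp [hFm, hxB, hxA, this]
      · have : x ∉ E := fun h => ((hEm x).1 h).elim hxA hxB
        simp [hFm, hxB, this]
  have htot : ∀ N, ∑ n ∈ Finset.range N, a n +
      ∑ n ∈ Finset.range N, ∑ x, u n x * (if x ∈ B then 1 else 0) + ∑ x, u N x = 1 := by
    intro N
    have := killedLaw_sum_eq (P := Pmat β h) E σ₀ (φ := fun _ => 1)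
      (r := fun x => if x ∈ E then 1 else 0)
      (fun x => by simp only [mul_one, hP.sum_one]; split_ifs <;> norm_num) N
    refine Eq.trans ?_ this
    rw [← Finset.sum_add_distrib]
    simp only [mul_one, hsplit, mul_add, Finset.sum_add_distrib, ha', hu]
  have hbn : ∀ N, 0 ≤ ∑ n ∈ Finset.range N, ∑ x, u n x * (if x ∈ B then 1 else 0) := fun N =>
    Finset.sum_nonneg fun n _ => Finset.sum_nonneg fun x _ =>
      mul_nonneg (hu0 n x) (by split_ifs <;> norm_num)
  have hun : ∀ N, 0 ≤ ∑ x, u N x := fun N => Finset.sum_nonneg fun x _ => hu0 N x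
  have hle : ∀ N, ∑ n ∈ Finset.range N, a n ≤ 1 := fun N => by
    linarith [htot N, hbn N, hun N]
  have hsum : Summable a := summable_of_sum_range_le ha0 hle
  have hlim := hsum.hasSum.tendsto_sum_nat
  refine ⟨?_, le_of_tendsto' hlim hle⟩
  have hsurv := killedLaw_survival hP (Pmat_pos β h) hEne σ₀
  have := hlim.add hsurv
  rw [add_zero] at this
  exact ge_of_tendsto' this fun N => by linarith [htot N, hb N]

/-- The total weight with which `B` is reached at the first visit to `K`. -/
lemma harmonic_le_of_killedLaw (β h : ℝ) (σ₀ : Config L) {K : Set (Config L)} (hK : K.Nonempty)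
    {φ r : Config L → ℝ} (hφ1 : ∀ x, φ x ≤ 1)
    (hφ : ∀ x, φ x = r x + (if x ∈ K then 0 else ∑ y, Pmat β h x y * φ y)) {b : ℝ}
    (hb : ∀ N, ∑ n ∈ Finset.range N, ∑ x, killedLaw (Pmat β h) K σ₀ n x * r x ≤ b) :
    φ σ₀ ≤ b := by
  have hP := isStoch_Pmat (L := L) β h
  have hsurv := killedLaw_survival hP (Pmat_pos β h) hK σ₀
  have := hsurv.const_add b
  rw [add_zero] at this
  refine ge_of_tendsto' this fun N => ?_
  rw [← killedLaw_sum_eq (P := Pmat β h) K σ₀ hφ N]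
  refine add_le_add (hb N) (Finset.sum_le_sum fun x _ => ?_)
  exact mul_le_of_le_one_right (killedLaw_nonneg hP K σ₀ N x) (hφ1 x)

end

section

variable {L : ℕ}

/-- The number of sites of `ω` whose translate by `d` is not in `ω`. -/
def bd (ω : Finset (Site L)) (d : Site L) : ℕ := (ω.filter fun x => x + d ∉ ω).card

/-- The number of nearest neighbours of `x` in `ω`. -/
def nb (ω : Finset (Site L)) (x : Site L) : ℕ :=
  (if x + east L ∈ ω then 1 else 0) + (if x - east L ∈ ω then 1 else 0) +
    (if x + north L ∈ ω then 1 else 0) + (if x - north L ∈ ω then 1 else 0)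

/-- The energy of a set of sites: twice its perimeter minus `2h` times its area. -/
noncomputable def Hn (h : ℝ) (ω : Finset (Site L)) : ℝ :=
  4 * (bd ω (east L) : ℝ) + 4 * (bd ω (north L) : ℝ) - 2 * h * (ω.card : ℝ)

@[simp] lemma bd_empty (d : Site L) : bd ∅ d = 0 := by simp [bd]

@[simp] lemma Hn_empty (h : ℝ) : Hn h (∅ : Finset (Site L)) = 0 := by simp [Hn]

@[simp] lemma nb_empty (x : Site L) : nb ∅ x = 0 := by simp [nb]

lemma bd_sub (ω : Finset (Site L)) (d : Site L) :
    bd ω d = (ω.filter fun x => x - d ∉ ω).card := by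
  have h1 : (ω.filter fun x => x + d ∈ ω).card = (ω.filter fun x => x - d ∈ ω).card := by
    refine Finset.card_bij (fun x _ => x + d) ?_ ?_ ?_
    · intro x hx
      simp only [Finset.mem_filter, add_sub_cancel_right] at hx ⊢
      exact ⟨hx.2, hx.1⟩
    · intro x _ y _ hxy
      exact add_right_cancel hxy
    · intro y hy
      simp only [Finset.mem_filter] at hy
      exact ⟨y - d, by simp [hy.1, hy.2], by simp⟩
  have h2 := Finset.card_filter_add_card_filter_not (s := ω) (fun x => x + d ∈ ω)
  have h3 := Finset.card_filter_add_card_filter_not (s := ω) (fun x => x - d ∈ ω)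
  unfold bd
  omega

lemma bd_insert {ω : Finset (Site L)} {x d : Site L} (hx : x ∉ ω) (hd : d ≠ 0) :
    bd (insert x ω) d + ((if x + d ∈ ω then 1 else 0) + (if x - d ∈ ω then 1 else 0)) =
      bd ω d + 1 := by
  have hxd : x + d ≠ x := by simpa using hd
  have e1 : (insert x ω).filter (fun y => y + d ∉ insert x ω) =
      (if x + d ∈ ω then ∅ else {x}) ∪ ((ω.filter fun y => y + d ∉ ω).erase (x - d)) := by
    ext y
    have hyd : y + d = x ↔ y = x - d := eq_sub_iff_add_eq.symm
    by_cases hyx : y = x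
    · subst hyx
      by_cases hyo : y + d ∈ ω <;> simp [hyo, hx, hd]
    · by_cases hyo : y + d ∈ ω <;> by_cases hxo : x + d ∈ ω <;>
        simp [hyo, hyx, hxo, hyd, and_comm]
  unfold bd
  rw [e1, Finset.card_union_of_disjoint]
  · by_cases h1 : x - d ∈ ω
    · have h2 : x - d ∈ ω.filter fun y => y + d ∉ ω := by simp [h1, hx]
      have h3 := Finset.card_erase_add_one h2
      by_cases h4 : x + d ∈ ω <;> simp only [h4, h1, if_true, if_false, Finset.card_empty,
        Finset.card_singleton] <;> omega
    · have h2 : x - d ∉ ω.filter fun y => y + d ∉ ω := by simp [h1]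
      rw [Finset.erase_eq_of_notMem h2]
      by_cases h4 : x + d ∈ ω <;> simp only [h4, h1, if_true, if_false, Finset.card_empty,
        Finset.card_singleton] <;> omega
  · by_cases h4 : x + d ∈ ω <;> simp [h4, hx]

lemma bd_submod (ω ω' : Finset (Site L)) (d : Site L) :
    bd (ω ∪ ω') d + bd (ω ∩ ω') d ≤ bd ω d + bd ω' d := by
  unfold bd
  rw [← Finset.card_union_add_card_inter (ω.filter _) (ω'.filter _),
    ← Finset.card_union_add_card_inter ((ω ∪ ω').filter _) ((ω ∩ ω').filter _)]
  refine add_le_add (Finset.card_le_card ?_) (Finset.card_le_card ?_)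
  · intro x hx
    simp only [Finset.mem_union, Finset.mem_filter, Finset.mem_inter] at hx ⊢
    tauto
  · intro x hx
    simp only [Finset.mem_union, Finset.mem_filter, Finset.mem_inter] at hx ⊢
    tauto

lemma Hn_submod (h : ℝ) (ω ω' : Finset (Site L)) :
    Hn h (ω ∪ ω') + Hn h (ω ∩ ω') ≤ Hn h ω + Hn h ω' := by
  have h1 : (bd (ω ∪ ω') (east L) : ℝ) + bd (ω ∩ ω') (east L) ≤
    bd ω (east L) + bd ω' (east L) := by exact_mod_cast bd_submod ω ω' (east L)
  have h2 : (bd (ω ∪ ω') (north L) : ℝ) + bd (ω ∩ ω') (north L) ≤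
    bd ω (north L) + bd ω' (north L) := by exact_mod_cast bd_submod ω ω' (north L)
  have h3 : ((ω ∪ ω').card : ℝ) + (ω ∩ ω').card = ω.card + ω'.card := by
    exact_mod_cast Finset.card_union_add_card_inter ω ω'
  unfold Hn
  linear_combination 4 * h1 + 4 * h2 - 2 * h * h3

lemma Hn_insert (hL : 2 ≤ L) (h : ℝ) {ω : Finset (Site L)} {x : Site L} (hx : x ∉ ω) :
    Hn h (insert x ω) = Hn h ω + (8 - 2 * h - 4 * (nb ω x : ℝ)) := by
  have : Fact (1 < L) := ⟨hL⟩
  have he : east L ≠ 0 := by simp [east, Prod.ext_iff]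
  have hn : north L ≠ 0 := by simp [north, Prod.ext_iff]
  have h1 := bd_insert hx he
  have h2 := bd_insert hx hn
  have h3 : bd (insert x ω) (east L) + bd (insert x ω) (north L) + nb ω x =
      bd ω (east L) + bd ω (north L) + 2 := by unfold nb; omega
  have h4 : (bd (insert x ω) (east L) : ℝ) + bd (insert x ω) (north L) + nb ω x =
      bd ω (east L) + bd ω (north L) + 2 := by exact_mod_cast h3
  unfold Hn
  rw [Finset.card_insert_of_notMem hx]
  push_cast
  linear_combination 4 * h4

/-! ### Parity classes -/

lemma chess_add_unit [NeZero L] (hL : Even L) {x d : Site L} (hd : d.1 + d.2 = 1) :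
    chessE L (x + d) = !chessE L x := by
  obtain ⟨k, hk⟩ := hL
  have h0 := NeZero.ne L
  have : Fact (1 < L) := ⟨by omega⟩
  have e : (x + d).1 + (x + d).2 = (x.1 + x.2) + 1 := by
    rw [← hd, Prod.fst_add, Prod.snd_add]; ring
  unfold chessE
  rw [e, ZMod.val_add, ZMod.val_one, Nat.mod_mod_of_dvd _ ⟨k, by omega⟩]
  generalize (x.1 + x.2).val = v
  rcases Nat.mod_two_eq_zero_or_one v with h | h
  · simp [Nat.add_mod, h]
  · simp [Nat.add_mod, h]

lemma Adj.chess [NeZero L] (hL : Even L) {x y : Site L} (hxy : Adj x y) :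
    chessE L y = !chessE L x := by
  have e1 : (east L).1 + (east L).2 = 1 := by simp [east]
  have e2 : (north L).1 + (north L).2 = 1 := by simp [north]
  rcases hxy with rfl | rfl | rfl | rfl
  · exact chess_add_unit hL e1
  · have := chess_add_unit hL (x := x - east L) e1
    rw [sub_add_cancel] at this
    rw [this, Bool.not_not]
  · exact chess_add_unit hL e2
  · have := chess_add_unit hL (x := x - north L) e2
    rw [sub_add_cancel] at this
    rw [this, Bool.not_not]

lemma nb_pos_iff {ω : Finset (Site L)} {x : Site L} : 0 < nb ω x ↔ ∃ y ∈ ω, Adj x y := by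
  constructor
  · intro hp
    by_contra! hc
    have h1 : x + east L ∉ ω := fun hm => hc _ hm (Or.inl rfl)
    have h2 : x - east L ∉ ω := fun hm => hc _ hm (Or.inr (Or.inl rfl))
    have h3 : x + north L ∉ ω := fun hm => hc _ hm (Or.inr (Or.inr (Or.inl rfl)))
    have h4 : x - north L ∉ ω := fun hm => hc _ hm (Or.inr (Or.inr (Or.inr rfl)))
    simp [nb, h1, h2, h3, h4] at hp
  · rintro ⟨y, hy, rfl | rfl | rfl | rfl⟩ <;> simp [nb, hy]

lemma nb_congr {ω ω' : Finset (Site L)} {x : Site L}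
    (hω : ∀ y, Adj x y → (y ∈ ω ↔ y ∈ ω')) : nb ω x = nb ω' x := by
  unfold nb
  rw [if_congr (hω _ (Or.inl rfl)) rfl rfl, if_congr (hω _ (Or.inr (Or.inl rfl))) rfl rfl,
    if_congr (hω _ (Or.inr (Or.inr (Or.inl rfl)))) rfl rfl,
    if_congr (hω _ (Or.inr (Or.inr (Or.inr rfl)))) rfl rfl]

/-- The set `a` consists of sites of the parity class `p`. -/
def InCls (p : Bool) (a : Finset (Site L)) : Prop := ∀ x ∈ a, chessE L x = p

lemma InCls.mono {p : Bool} {a b : Finset (Site L)} (hb : InCls p b) (hab : a ⊆ b) : InCls p a :=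
  fun x hx => hb x (hab hx)

lemma InCls.disjoint {p : Bool} {a b : Finset (Site L)} (ha : InCls p a) (hb : InCls (!p) b) :
    Disjoint a b := by
  rw [Finset.disjoint_left]
  intro x hxa hxb
  have := ha x hxa
  rw [hb x hxb] at this
  simp at this

variable [NeZero L]

lemma two_le_of_even (hL : Even L) : 2 ≤ L := by
  obtain ⟨k, hk⟩ := hL
  have := NeZero.ne L
  omega

lemma nb_union_cls (hL : Even L) {p : Bool} {a b : Finset (Site L)} (hb : InCls (!p) b)
    {x : Site L} (hx : chessE L x = !p) : nb (a ∪ b) x = nb a x := by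
  refine nb_congr fun y hy => ?_
  have hyb : y ∉ b := fun hm => by
    have := hb y hm
    rw [hy.chess hL, hx] at this
    simp at this
  simp [hyb]

lemma Hn_union_cls (hL : Even L) (h : ℝ) {p : Bool} {a b : Finset (Site L)} (ha : InCls p a)
    (hb : InCls (!p) b) :
    Hn h (a ∪ b) = Hn h a + ∑ x ∈ b, (8 - 2 * h - 4 * (nb a x : ℝ)) := by
  induction b using Finset.induction_on with
  | empty => simp
  | insert x b hxb ih =>
    have hb' : InCls (!p) b := hb.mono (Finset.subset_insert _ _)
    have hx : chessE L x = !p := hb x (Finset.mem_insert_self _ _)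
    have hxa : x ∉ a := fun hm => by
      have := ha x hm
      rw [hx] at this
      simp at this
    rw [Finset.sum_insert hxb, Finset.union_insert, Hn_insert (two_le_of_even hL) h (by simp [hxa, hxb]),
      ih hb', nb_union_cls hL hb' hx]
    ring

lemma Hn_cls (hL : Even L) (h : ℝ) {p : Bool} {a : Finset (Site L)} (ha : InCls p a) :
    Hn h a = (8 - 2 * h) * (a.card : ℝ) := by
  have := Hn_union_cls hL h (p := !p) (a := ∅) (b := a) (by simp [InCls]) (by simpa using ha)
  simp only [Finset.empty_union, Hn_empty, nb_empty, Nat.cast_zero, mul_zero, sub_zero, zero_add,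
    Finset.sum_const, nsmul_eq_mul] at this
  rw [this, mul_comm]

end

section

variable {L : ℕ}

lemma subset_product (ω : Finset (Site L)) : ω ⊆ ω.image Prod.fst ×ˢ ω.image Prod.snd :=
  fun _ hx => Finset.mem_product.2
    ⟨Finset.mem_image_of_mem _ hx, Finset.mem_image_of_mem _ hx⟩

variable [NeZero L]

/-- A finite proper subset of the cycle with a single starting point is an interval. -/
lemma exists_interval {S : Finset (ZMod L)} {c : ZMod L} (hc : c ∈ S) (hS : S.card < L)
    (huniq : ∀ x ∈ S, x - 1 ∉ S → x = c) :
    ∀ y, y ∈ S ↔ ∃ i : ℕ, i < S.card ∧ y = c + (i : ZMod L) := by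
  have hex : ∃ k : ℕ, c + (k : ZMod L) ∉ S := by
    by_contra! hall
    have : S = Finset.univ := by
      refine Finset.eq_univ_of_forall fun y => ?_
      have := hall (y - c).val
      rwa [ZMod.natCast_zmod_val, add_sub_cancel] at this
    rw [this, Finset.card_univ, ZMod.card] at hS
    exact lt_irrefl _ hS
  have hm := Nat.find_spec hex
  have hlt : ∀ k < Nat.find hex, c + (k : ZMod L) ∈ S := fun k hk => by
    simpa using Nat.find_min hex hk
  generalize Nat.find hex = m at hm hlt
  have hmem : ∀ y, y ∈ S ↔ ∃ i : ℕ, i < m ∧ y = c + (i : ZMod L) := by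
    intro y
    constructor
    · intro hy
      by_contra hno
      have hback : ∀ k : ℕ, y - (k : ZMod L) ∈ S ∧ ¬ ∃ i : ℕ, i < m ∧ y - (k : ZMod L) = c + i := by
        intro k
        induction k with
        | zero => simpa using ⟨hy, by simpa using hno⟩
        | succ k ih =>
          obtain ⟨h1, h2⟩ := ih
          have e : y - ((k + 1 : ℕ) : ZMod L) = y - (k : ZMod L) - 1 := by push_cast; ring
          rw [e]
          have h3 : y - (k : ZMod L) - 1 ∈ S := by
            by_contra h3
            refine h2 ⟨0, ?_, by simpa using huniq _ h1 h3⟩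
            rcases Nat.eq_zero_or_pos m with h0 | h0
            · rw [h0] at hm
              exact absurd hc (by simpa using hm)
            · exact h0
          refine ⟨h3, ?_⟩
          rintro ⟨i, hi, hie⟩
          have h4 : y - (k : ZMod L) = c + ((i + 1 : ℕ) : ZMod L) := by
            push_cast; linear_combination hie
          rcases Nat.lt_or_ge (i + 1) m with h5 | h5
          · exact h2 ⟨i + 1, h5, h4⟩
          · have : i + 1 = m := by omega
            rw [h4, this] at h1
            exact hm h1
      have := (hback (y - c).val).2
      refine this ⟨0, ?_, by simp⟩
      rcases Nat.eq_zero_or_pos m with h0 | h0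
      · rw [h0] at hm
        exact absurd hc (by simpa using hm)
      · exact h0
    · rintro ⟨i, hi, rfl⟩
      exact hlt i hi
  have himg : S = (Finset.range m).image fun i : ℕ => c + (i : ZMod L) := by
    ext y
    rw [hmem, Finset.mem_image]
    simp only [Finset.mem_range, eq_comm]
  have hmL : m ≤ L := by
    by_contra hlt'
    push Not at hlt'
    have : S = Finset.univ := by
      refine Finset.eq_univ_of_forall fun y => (hmem y).2 ⟨(y - c).val, ?_, by simp⟩
      exact (ZMod.val_lt _).trans hlt'
    rw [this, Finset.card_univ, ZMod.card] at hS
    exact lt_irrefl _ hS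
  have hcard : S.card = m := by
    rw [himg, Finset.card_image_of_injOn, Finset.card_range]
    intro i hi j hj hij
    simp only [Finset.coe_range, Set.mem_Iio] at hi hj
    have := congrArg ZMod.val (add_left_cancel hij)
    rwa [ZMod.val_natCast_of_lt (by omega), ZMod.val_natCast_of_lt (by omega)] at this
  rw [hcard]
  exact hmem

lemma exists_column_start {ω : Finset (Site L)} (hω : ω.card < L) {x : Site L} (hx : x ∈ ω) :
    ∃ y ∈ ω, y.1 = x.1 ∧ y - north L ∉ ω := by
  by_contra! hall
  have hback : ∀ k : ℕ, (x.1, x.2 - (k : ZMod L)) ∈ ω := by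
    intro k
    induction k with
    | zero => simpa using hx
    | succ k ih =>
      have := hall _ ih rfl
      simpa [north, sub_sub] using this
  have hcard : (Finset.univ.image fun k : ZMod L => (x.1, k)).card = L := by
    rw [Finset.card_image_of_injective _ (fun a b hab => (Prod.ext_iff.1 hab).2), Finset.card_univ,
      ZMod.card]
  have : (Finset.univ.image fun k : ZMod L => (x.1, k)) ⊆ ω := by
    intro y hy
    obtain ⟨k, -, rfl⟩ := Finset.mem_image.1 hy
    have := hback (x.2 - k).val
    simpa using this
  have := Finset.card_le_card this
  omega

lemma exists_row_start {ω : Finset (Site L)} (hω : ω.card < L) {x : Site L} (hx : x ∈ ω) :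
    ∃ y ∈ ω, y.2 = x.2 ∧ y - east L ∉ ω := by
  by_contra! hall
  have hback : ∀ k : ℕ, (x.1 - (k : ZMod L), x.2) ∈ ω := by
    intro k
    induction k with
    | zero => simpa using hx
    | succ k ih =>
      have := hall _ ih rfl
      simpa [east, sub_sub] using this
  have hcard : (Finset.univ.image fun k : ZMod L => (k, x.2)).card = L := by
    rw [Finset.card_image_of_injective _ (fun a b hab => (Prod.ext_iff.1 hab).1), Finset.card_univ,
      ZMod.card]
  have : (Finset.univ.image fun k : ZMod L => (k, x.2)) ⊆ ω := by
    intro y hy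
    obtain ⟨k, -, rfl⟩ := Finset.mem_image.1 hy
    have := hback (x.1 - k).val
    simpa using this
  have := Finset.card_le_card this
  omega

lemma card_fst_le {ω : Finset (Site L)} (hω : ω.card < L) :
    (ω.image Prod.fst).card ≤ bd ω (north L) := by
  rw [bd_sub]
  refine (Finset.card_le_card ?_).trans (Finset.card_image_le (f := Prod.fst))
  intro i hi
  obtain ⟨x, hx, rfl⟩ := Finset.mem_image.1 hi
  obtain ⟨y, hy, hyx, hyn⟩ := exists_column_start hω hx
  exact Finset.mem_image.2 ⟨y, Finset.mem_filter.2 ⟨hy, hyn⟩, hyx⟩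

lemma card_snd_le {ω : Finset (Site L)} (hω : ω.card < L) :
    (ω.image Prod.snd).card ≤ bd ω (east L) := by
  rw [bd_sub]
  refine (Finset.card_le_card ?_).trans (Finset.card_image_le (f := Prod.snd))
  intro i hi
  obtain ⟨x, hx, rfl⟩ := Finset.mem_image.1 hi
  obtain ⟨y, hy, hyx, hyn⟩ := exists_row_start hω hx
  exact Finset.mem_image.2 ⟨y, Finset.mem_filter.2 ⟨hy, hyn⟩, hyx⟩

/-- The sides of a bounding box of `ω`, which control its energy and its area. -/
lemma exists_sides (h : ℝ) {ω : Finset (Site L)} (hω : ω.card < L) :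
    ∃ p q : ℕ, ω.card ≤ p * q ∧ 4 * ((p : ℝ) + q) - 2 * h * ω.card ≤ Hn h ω := by
  refine ⟨(ω.image Prod.fst).card, (ω.image Prod.snd).card, ?_, ?_⟩
  · rw [← Finset.card_product]
    exact Finset.card_le_card (subset_product ω)
  · have h1 : (((ω.image Prod.fst).card : ℕ) : ℝ) ≤ bd ω (north L) := by
      exact_mod_cast card_fst_le hω
    have h2 : (((ω.image Prod.snd).card : ℕ) : ℝ) ≤ bd ω (east L) := by
      exact_mod_cast card_snd_le hω
    unfold Hn
    linarith

/-! ### The critical size -/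

/-- The area of the critical quasi-square. -/
noncomputable def critN (h : ℝ) : ℕ := lam h * (lam h - 1)

lemma lam_facts {h : ℝ} (h0 : 0 < h) (h1 : h < 1) :
    3 ≤ lam h ∧ 2 < h * lam h ∧ h * ((lam h : ℝ) - 1) ≤ 2 := by
  have hn : (0 : ℝ) ≤ 2 / h := by positivity
  have e : ((lam h : ℕ) : ℝ) = (Nat.floor (2 / h) : ℝ) + 1 := by unfold lam; push_cast; ring
  have h2 : (2 : ℝ) ≤ 2 / h := by rw [le_div_iff₀ h0]; linarith
  refine ⟨?_, ?_, ?_⟩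
  · have : 2 ≤ Nat.floor (2 / h) := Nat.le_floor (by exact_mod_cast h2)
    unfold lam
    omega
  · have := Nat.lt_floor_add_one (2 / h)
    rw [← e, div_lt_iff₀ h0] at this
    linarith
  · have := Nat.floor_le hn
    rw [le_div_iff₀ h0] at this
    rw [e]
    linarith

lemma critN_cast {h : ℝ} (h0 : 0 < h) (h1 : h < 1) :
    (critN h : ℝ) = (lam h : ℝ) * ((lam h : ℝ) - 1) := by
  have := (lam_facts h0 h1).1
  unfold critN
  rw [Nat.cast_mul, Nat.cast_sub (by omega), Nat.cast_one]

lemma Gam_eq {h : ℝ} (h0 : 0 < h) (h1 : h < 1) :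
    Gam h = 8 * (lam h : ℝ) - 2 * h * ((critN h : ℝ) + 1) := by
  rw [critN_cast h0 h1]
  unfold Gam
  ring

lemma Hn_pos_of_card_le {h : ℝ} (h0 : 0 < h) (h1 : h < 1) {ω : Finset (Site L)}
    (hL : critN h < L) (hω : ω.Nonempty) (hc : ω.card ≤ critN h) : 0 < Hn h ω := by
  obtain ⟨p, q, hpq, hH⟩ := exists_sides h (hc.trans_lt hL)
  obtain ⟨-, -, hl⟩ := lam_facts h0 h1
  refine lt_of_lt_of_le ?_ hH
  have hn : (1 : ℝ) ≤ ω.card := by exact_mod_cast hω.card_pos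
  have hpq' : (ω.card : ℝ) ≤ (p : ℝ) * q := by exact_mod_cast hpq
  have hc' : (ω.card : ℝ) ≤ (lam h : ℝ) * ((lam h : ℝ) - 1) := by
    rw [← critN_cast h0 h1]; exact_mod_cast hc
  by_contra hneg
  push Not at hneg
  have hp : (0 : ℝ) ≤ p := p.cast_nonneg
  have hq : (0 : ℝ) ≤ q := q.cast_nonneg
  set n : ℝ := (ω.card : ℝ)
  set l : ℝ := (lam h : ℝ)
  have hs : 2 * ((p : ℝ) + q) ≤ h * n := by linarith
  have h3 : 16 * n ≤ h * n * (h * n) := by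
    calc 16 * n ≤ (2 * ((p : ℝ) + q)) * (2 * ((p : ℝ) + q)) := by nlinarith [sq_nonneg ((p : ℝ) - q)]
      _ ≤ _ := by gcongr
  have h4 : 16 ≤ h * h * n := by nlinarith
  have h5 : h * h * n ≤ (h * l) * (h * (l - 1)) := by
    nlinarith [mul_le_mul_of_nonneg_left hc' (mul_nonneg h0.le h0.le)]
  have h6 : h * l ≤ 3 := by linarith
  nlinarith [mul_nonneg h0.le (show (0 : ℝ) ≤ l from (lam h).cast_nonneg)]

lemma sides_of_area {l p q : ℕ} (hl : 2 ≤ l) (h : l * (l - 1) ≤ p * q) : 2 * l - 1 ≤ p + q := by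
  by_contra hlt
  push Not at hlt
  obtain ⟨k, rfl⟩ : ∃ k, l = k + 1 := ⟨l - 1, by omega⟩
  simp only [Nat.add_sub_cancel] at h
  have h1 : p + q ≤ 2 * k := by omega
  zify at h h1 hl
  have hp : (0 : ℤ) ≤ p := by positivity
  have hq : (0 : ℤ) ≤ q := by positivity
  nlinarith [sq_nonneg ((p : ℤ) - q)]

lemma sides_of_area_succ {l p q : ℕ} (h : l * (l - 1) + 1 ≤ p * q) : 2 * l ≤ p + q := by
  by_contra hlt
  push Not at hlt
  rcases Nat.eq_zero_or_pos l with rfl | hl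
  · omega
  obtain ⟨k, rfl⟩ : ∃ k, l = k + 1 := ⟨l - 1, by omega⟩
  simp only [Nat.add_sub_cancel] at h
  have h1 : p + q ≤ 2 * k + 1 := by omega
  zify at h h1
  have hp : (0 : ℤ) ≤ p := by positivity
  have hq : (0 : ℤ) ≤ q := by positivity
  have hk : (0 : ℤ) ≤ k := by positivity
  rcases lt_trichotomy (p : ℤ) q with h2 | h2 | h2
  · nlinarith [mul_self_nonneg ((p : ℤ) - q + 1)]
  · nlinarith
  · nlinarith [mul_self_nonneg ((q : ℤ) - p + 1)]

lemma Gam_le_of_card {h : ℝ} (h0 : 0 < h) (h1 : h < 1) {ω : Finset (Site L)}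
    (hL : critN h + 1 < L) (hc : ω.card = critN h + 1) : Gam h ≤ Hn h ω := by
  obtain ⟨p, q, hpq, hH⟩ := exists_sides h (hc.trans_lt hL)
  refine le_trans ?_ hH
  have := sides_of_area_succ (l := lam h) (hc ▸ hpq)
  have h2 : 2 * (lam h : ℝ) ≤ p + q := by exact_mod_cast this
  rw [Gam_eq h0 h1, hc]
  push_cast
  linarith

/-- `ω` is (the interior of) a critical quasi-square. -/
def IsQuasiSq (h : ℝ) (ω : Finset (Site L)) : Prop :=
  ∃ (c : Site L) (a b : ℕ), ((a = lam h - 1 ∧ b = lam h) ∨ (a = lam h ∧ b = lam h - 1)) ∧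
    ∀ x, x ∈ ω ↔ x ∈ rect c a b

lemma sides_unique {l p q : ℕ} (hl : 1 ≤ l) (h1 : p + q = 2 * l - 1) (h2 : p * q = l * (l - 1)) :
    (p = l - 1 ∧ q = l) ∨ (p = l ∧ q = l - 1) := by
  obtain ⟨k, rfl⟩ : ∃ k, l = k + 1 := ⟨l - 1, by omega⟩
  simp only [Nat.add_sub_cancel] at h2 ⊢
  have h3 : p + q = 2 * k + 1 := by omega
  zify at h2 h3 ⊢
  have : ((p : ℤ) - k) * (p - (k + 1)) = 0 := by
    have hq : (q : ℤ) = 2 * k + 1 - p := by linarith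
    rw [hq] at h2
    linarith
  rcases mul_eq_zero.1 this with h | h
  · left; constructor <;> linarith
  · right; constructor <;> linarith

lemma sides_area_le {l p q : ℕ} (hl : 1 ≤ l) (h : p + q ≤ 2 * l - 1) : p * q ≤ l * (l - 1) := by
  by_contra hlt
  push Not at hlt
  have := sides_of_area_succ (l := l) (p := p) (q := q) hlt
  omega

lemma isQuasiSq_of_le {h : ℝ} (h0 : 0 < h) (h1 : h < 1) {ω : Finset (Site L)}
    (hL : critN h < L) (hc : ω.card = critN h) (hH : Hn h ω ≤ Gam h) :
    IsQuasiSq h ω ∧ Hn h ω = Gam h - (4 - 2 * h) := by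
  have hωL : ω.card < L := by omega
  obtain ⟨hl3, -, -⟩ := lam_facts h0 h1
  have hp := card_fst_le hωL
  have hq := card_snd_le hωL
  have hsub := subset_product ω
  have hpq := Finset.card_le_card hsub
  rw [Finset.card_product, hc] at hpq
  have hs := sides_of_area (l := lam h) (by omega) hpq
  have hup : bd ω (east L) + bd ω (north L) ≤ 2 * lam h - 1 := by
    have : (bd ω (east L) : ℝ) + bd ω (north L) < 2 * lam h := by
      rw [Gam_eq h0 h1] at hH
      unfold Hn at hH
      rw [hc] at hH
      linarith
    have : bd ω (east L) + bd ω (north L) < 2 * lam h := by exact_mod_cast this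
    omega
  have harea : (ω.image Prod.fst).card * (ω.image Prod.snd).card = critN h :=
    le_antisymm (sides_area_le (by omega) (by omega)) hpq
  have hprod : ω = ω.image Prod.fst ×ˢ ω.image Prod.snd :=
    Finset.eq_of_subset_of_card_le hsub (by rw [Finset.card_product, harea, hc])
  have hsides := sides_unique (l := lam h) (by omega) (by omega) harea
  have hstartn : ∀ y ∈ ω, ∀ y' ∈ ω, y - north L ∉ ω → y' - north L ∉ ω → y.1 = y'.1 → y = y' := by
    intro y hy y' hy' hyn hyn' h1
    have hcard : (ω.filter fun x => x - north L ∉ ω).card ≤ (ω.image Prod.fst).card := by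
      rw [← bd_sub]; omega
    have hinj := Finset.injOn_of_surjOn_of_card_le (s := ω.filter fun x => x - north L ∉ ω)
      (t := ω.image Prod.fst) Prod.fst
      (fun x hx => Finset.mem_image_of_mem _ (Finset.mem_filter.1 hx).1)
      (fun i hi => by
        obtain ⟨x, hx, rfl⟩ := Finset.mem_image.1 (Finset.mem_coe.1 hi)
        obtain ⟨z, hz, hzx, hzn⟩ := exists_column_start hωL hx
        exact ⟨z, Finset.mem_coe.2 (Finset.mem_filter.2 ⟨hz, hzn⟩), hzx⟩) hcard
    exact hinj (Finset.mem_coe.2 (Finset.mem_filter.2 ⟨hy, hyn⟩))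
      (Finset.mem_coe.2 (Finset.mem_filter.2 ⟨hy', hyn'⟩)) h1
  have hstarte : ∀ y ∈ ω, ∀ y' ∈ ω, y - east L ∉ ω → y' - east L ∉ ω → y.2 = y'.2 → y = y' := by
    intro y hy y' hy' hyn hyn' h1
    have hcard : (ω.filter fun x => x - east L ∉ ω).card ≤ (ω.image Prod.snd).card := by
      rw [← bd_sub]; omega
    have hinj := Finset.injOn_of_surjOn_of_card_le (s := ω.filter fun x => x - east L ∉ ω)
      (t := ω.image Prod.snd) Prod.snd
      (fun x hx => Finset.mem_image_of_mem _ (Finset.mem_filter.1 hx).1)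
      (fun i hi => by
        obtain ⟨x, hx, rfl⟩ := Finset.mem_image.1 (Finset.mem_coe.1 hi)
        obtain ⟨z, hz, hzx, hzn⟩ := exists_row_start hωL hx
        exact ⟨z, Finset.mem_coe.2 (Finset.mem_filter.2 ⟨hz, hzn⟩), hzx⟩) hcard
    exact hinj (Finset.mem_coe.2 (Finset.mem_filter.2 ⟨hy, hyn⟩))
      (Finset.mem_coe.2 (Finset.mem_filter.2 ⟨hy', hyn'⟩)) h1
  have hmem : ∀ x : Site L, x ∈ ω ↔ x.1 ∈ ω.image Prod.fst ∧ x.2 ∈ ω.image Prod.snd := by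
    intro x
    conv_lhs => rw [hprod]
    exact Finset.mem_product
  generalize hI : ω.image Prod.fst = I at *
  generalize hJ : ω.image Prod.snd = J at *
  have hN : 0 < critN h := by
    unfold critN
    exact Nat.mul_pos (by omega) (by omega)
  obtain ⟨x₀, hx₀⟩ : ω.Nonempty := Finset.card_pos.1 (by omega)
  obtain ⟨u, hu, -, hun⟩ := exists_row_start hωL hx₀
  obtain ⟨v, hv, -, hvn⟩ := exists_column_start hωL hx₀
  have hIL : I.card < L := by
    have := hpq; have : 1 ≤ J.card := by omega
    nlinarith
  have hJL : J.card < L := by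
    have : 1 ≤ I.card := by omega
    nlinarith
  have hu' := (hmem u).1 hu
  have hv' := (hmem v).1 hv
  have hIint := exists_interval hu'.1 hIL (fun x hx hx1 => by
    have h2 : ((x, u.2) : Site L) ∈ ω := (hmem _).2 ⟨hx, hu'.2⟩
    have h3 : ((x, u.2) : Site L) - east L ∉ ω := fun hm => hx1 (by simpa [east] using ((hmem _).1 hm).1)
    exact (Prod.ext_iff.1 (hstarte _ h2 _ hu h3 hun rfl)).1)
  have hJint := exists_interval hv'.2 hJL (fun x hx hx1 => by
    have h2 : ((v.1, x) : Site L) ∈ ω := (hmem _).2 ⟨hv'.1, hx⟩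
    have h3 : ((v.1, x) : Site L) - north L ∉ ω :=
      fun hm => hx1 (by simpa [north] using ((hmem _).1 hm).2)
    exact (Prod.ext_iff.1 (hstartn _ h2 _ hv h3 hvn rfl)).2)
  refine ⟨⟨(u.1, v.2), I.card, J.card, hsides, fun x => ?_⟩, ?_⟩
  · rw [hmem, hIint, hJint]
    constructor
    · rintro ⟨⟨i, hi, hxi⟩, ⟨j, hj, hxj⟩⟩
      exact ⟨i, j, hi, hj, Prod.ext hxi hxj⟩
    · rintro ⟨i, j, hi, hj, rfl⟩
      exact ⟨⟨i, hi, rfl⟩, ⟨j, hj, rfl⟩⟩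
  · have h5 : bd ω (east L) + bd ω (north L) + 1 = 2 * lam h := by omega
    have h6 : (bd ω (east L) : ℝ) + bd ω (north L) + 1 = 2 * lam h := by exact_mod_cast h5
    rw [Gam_eq h0 h1]
    unfold Hn
    rw [hc]
    linear_combination 4 * h6

end

section

variable {L : ℕ} [NeZero L]

/-- The sites of parity class `q` with at least two neighbours in `a`. -/
noncomputable def drift (q : Bool) (a : Finset (Site L)) : Finset (Site L) :=
  Finset.univ.filter fun x => chessE L x = q ∧ 2 ≤ nb a x

lemma mem_drift {q : Bool} {a : Finset (Site L)} {x : Site L} :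
    x ∈ drift q a ↔ chessE L x = q ∧ 2 ≤ nb a x := by simp [drift]

lemma drift_cls (q : Bool) (a : Finset (Site L)) : InCls q (drift q a) :=
  fun _ hx => (mem_drift.1 hx).1

/-- A set of class `p` whose closure under the drift has at most the critical area. -/
def Inner (h : ℝ) (p : Bool) (a : Finset (Site L)) : Prop :=
  (a ∪ drift (!p) a).card ≤ critN h

lemma inner_empty (h : ℝ) (p : Bool) : Inner h p (∅ : Finset (Site L)) := by
  simp [Inner, drift]

lemma Inner.card_le {h : ℝ} {p : Bool} {a : Finset (Site L)} (ha : Inner h p a) :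
    a.card ≤ critN h :=
  (Finset.card_le_card Finset.subset_union_left).trans ha

lemma theta_neg {h : ℝ} (h0 : 0 < h) {n : ℕ} (hn : 2 ≤ n) : 8 - 2 * h - 4 * (n : ℝ) < 0 := by
  have : (2 : ℝ) ≤ n := by exact_mod_cast hn
  linarith

lemma theta_pos {h : ℝ} (h1 : h < 1) {n : ℕ} (hn : ¬ 2 ≤ n) : 0 < 8 - 2 * h - 4 * (n : ℝ) := by
  have : (n : ℝ) ≤ 1 := by
    have : n ≤ 1 := by omega
    exact_mod_cast this
  linarith

lemma Hn_extend (hL : Even L) (h : ℝ) {p : Bool} {a b b' : Finset (Site L)} (ha : InCls p a)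
    (hb' : InCls (!p) b') (hbb : b ⊆ b') :
    Hn h (a ∪ b') = Hn h (a ∪ b) + ∑ x ∈ b' \ b, (8 - 2 * h - 4 * (nb a x : ℝ)) := by
  rw [Hn_union_cls hL h ha hb', Hn_union_cls hL h ha (hb'.mono hbb), ← Finset.sum_sdiff hbb]
  ring

lemma Hn_drift_le {h : ℝ} (h0 : 0 < h) (h1 : h < 1) (hL : Even L) {p : Bool}
    {a b : Finset (Site L)} (ha : InCls p a) (hb : InCls (!p) b) :
    Hn h (a ∪ drift (!p) a) ≤ Hn h (a ∪ b) := by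
  have e1 := Hn_extend hL h ha (drift_cls (!p) a)
    (Finset.inter_subset_right : b ∩ drift (!p) a ⊆ drift (!p) a)
  have e2 := Hn_extend hL h ha hb (Finset.inter_subset_left : b ∩ drift (!p) a ⊆ b)
  have e3 : ∑ x ∈ drift (!p) a \ (b ∩ drift (!p) a), (8 - 2 * h - 4 * (nb a x : ℝ)) ≤ 0 :=
    Finset.sum_nonpos fun x hx =>
      (theta_neg h0 (mem_drift.1 (Finset.mem_sdiff.1 hx).1).2).le
  have e4 : 0 ≤ ∑ x ∈ b \ (b ∩ drift (!p) a), (8 - 2 * h - 4 * (nb a x : ℝ)) :=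
    Finset.sum_nonneg fun x hx => by
      refine (theta_pos h1 fun hn => ?_).le
      obtain ⟨hxb, hx2⟩ := Finset.mem_sdiff.1 hx
      exact hx2 (Finset.mem_inter.2 ⟨hxb, mem_drift.2 ⟨hb x hxb, hn⟩⟩)
  linarith

lemma Inner.Hn_nonneg {h : ℝ} (h0 : 0 < h) (h1 : h < 1) (hL : Even L) (hLN : critN h + 1 < L)
    {p : Bool} {a b : Finset (Site L)} (ha : InCls p a) (hb : InCls (!p) b) (hI : Inner h p a) :
    0 ≤ Hn h (a ∪ b) := by
  refine le_trans ?_ (Hn_drift_le h0 h1 hL ha hb)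
  rcases Finset.eq_empty_or_nonempty (a ∪ drift (!p) a) with he | hne
  · rw [he, Hn_empty]
  · exact (Hn_pos_of_card_le h0 h1 (by omega) hne hI).le

lemma Inner.eq_empty {h : ℝ} (h0 : 0 < h) (h1 : h < 1) (hL : Even L) (hLN : critN h + 1 < L)
    {p : Bool} {a b : Finset (Site L)} (ha : InCls p a) (hb : InCls (!p) b) (hI : Inner h p a)
    (hH : Hn h (a ∪ b) ≤ 0) : a = ∅ ∧ b = ∅ := by
  have he : a = ∅ := by
    by_contra hne
    have : (a ∪ drift (!p) a).Nonempty :=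
      (Finset.nonempty_iff_ne_empty.2 hne).mono Finset.subset_union_left
    have h2 := Hn_pos_of_card_le h0 h1 (by omega) this hI
    have h3 := Hn_drift_le h0 h1 hL ha hb
    linarith
  refine ⟨he, ?_⟩
  rw [he, Finset.empty_union, Hn_cls hL h hb] at hH
  by_contra hne
  have : (1 : ℝ) ≤ b.card := by exact_mod_cast (Finset.nonempty_iff_ne_empty.2 hne).card_pos
  nlinarith

/-- The gate: a transition of energy at most `Γ` out of the inner region passes through a
protocritical droplet. -/
lemma Inner.gate {h : ℝ} (h0 : 0 < h) (h1 : h < 1) (hL : Even L) (hLN : critN h + 1 < L)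
    {p : Bool} {a b : Finset (Site L)} (ha : InCls p a) (hb : InCls (!p) b) (hI : Inner h p a)
    (hH : Hn h (a ∪ b) ≤ Gam h) :
    Inner h (!p) b ∨ (Hn h (a ∪ b) = Gam h ∧ ∃ (R : Finset (Site L)) (y : Site L),
      IsQuasiSq h R ∧ y ∉ R ∧ chessE L y = !p ∧ 0 < nb R y ∧ a ∪ b = insert y R) := by
  have hdis := ha.disjoint hb
  rcases Nat.lt_or_ge (critN h) (a ∪ b).card with hgt | hle
  · right
    set m := drift (!p) a with hm
    have hdm : Disjoint a (b ∩ m) := ha.disjoint (hb.mono Finset.inter_subset_left)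
    have hc0 : (a ∪ (b ∩ m)).card ≤ critN h :=
      (Finset.card_le_card (Finset.union_subset_union_right Finset.inter_subset_right)).trans hI
    rw [Finset.card_union_of_disjoint hdm] at hc0
    rw [Finset.card_union_of_disjoint hdis] at hgt
    obtain ⟨B, hB0, hBb, hBc⟩ := Finset.exists_subsuperset_card_eq
      (Finset.inter_subset_left : b ∩ m ⊆ b) (n := critN h - a.card) (by omega) (by omega)
    have hBcls : InCls (!p) B := hb.mono hBb
    have hBN : (a ∪ B).card = critN h := by
      rw [Finset.card_union_of_disjoint (ha.disjoint hBcls)]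
      omega
    have hpos : ∀ x ∈ b \ B, 0 < 8 - 2 * h - 4 * (nb a x : ℝ) := fun x hx => by
      obtain ⟨hxb, hxB⟩ := Finset.mem_sdiff.1 hx
      refine theta_pos h1 fun hn => hxB (hB0 (Finset.mem_inter.2 ⟨hxb, ?_⟩))
      exact mem_drift.2 ⟨hb x hxb, hn⟩
    have e1 := Hn_extend hL h ha hb hBb
    have hsum : 0 ≤ ∑ x ∈ b \ B, (8 - 2 * h - 4 * (nb a x : ℝ)) :=
      Finset.sum_nonneg fun x hx => (hpos x hx).le
    obtain ⟨hqs, hqH⟩ := isQuasiSq_of_le h0 h1 (by omega) hBN (by linarith)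
    have hne : (b \ B).Nonempty := by
      rw [Finset.nonempty_iff_ne_empty]
      intro he
      have : b ⊆ B := Finset.sdiff_eq_empty_iff_subset.1 he
      have := Finset.card_le_card this
      omega
    obtain ⟨y, hy⟩ := hne
    obtain ⟨hyb, hyB⟩ := Finset.mem_sdiff.1 hy
    have hyc := hb y hyb
    have hya : y ∉ a := fun hm => Finset.disjoint_left.1 hdis hm hyb
    have hyR : y ∉ a ∪ B := by simp [hya, hyB]
    have hins : insert y B ⊆ b := Finset.insert_subset hyb hBb
    have e2 := Hn_extend hL h ha hb hins
    have hcard : (a ∪ insert y B).card = critN h + 1 := by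
      rw [Finset.union_insert, Finset.card_insert_of_notMem hyR, hBN]
    have hge := Gam_le_of_card h0 h1 hLN hcard
    have hbeq : b = insert y B := by
      refine Finset.Subset.antisymm ?_ hins
      by_contra hns
      obtain ⟨z, hzb, hz⟩ := Finset.not_subset.1 hns
      have : 0 < ∑ x ∈ b \ insert y B, (8 - 2 * h - 4 * (nb a x : ℝ)) := by
        refine Finset.sum_pos (fun x hx => hpos x ?_) ⟨z, Finset.mem_sdiff.2 ⟨hzb, hz⟩⟩
        obtain ⟨h2, h3⟩ := Finset.mem_sdiff.1 hx
        exact Finset.mem_sdiff.2 ⟨h2, fun h4 => h3 (Finset.mem_insert_of_mem h4)⟩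
      linarith
    have hHeq : Hn h (a ∪ b) = Gam h := le_antisymm hH (by rw [hbeq]; exact hge)
    refine ⟨hHeq, a ∪ B, y, hqs, hyR, hyc, ?_, by rw [hbeq, Finset.union_insert]⟩
    by_contra hnb
    have hnb0 : nb (a ∪ B) y = 0 := by omega
    have := Hn_insert (two_le_of_even hL) h hyR
    rw [← Finset.union_insert, ← hbeq, hHeq, hqH, hnb0] at this
    norm_num at this
    linarith
  · left
    have ha' : InCls (!!p) a := by simpa using ha
    set m := drift (!!p) b with hm
    have hmcls : InCls (!!p) (a ∪ m) := by
      intro x hx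
      rcases Finset.mem_union.1 hx with hx | hx
      · exact ha' x hx
      · exact drift_cls _ _ x hx
    unfold Inner
    by_contra hgt
    push Not at hgt
    have hgt' : critN h < (b ∪ (a ∪ m)).card := lt_of_lt_of_le hgt
      (Finset.card_le_card (Finset.union_subset_union_right Finset.subset_union_right))
    rw [Finset.card_union_of_disjoint hdis] at hle
    rw [Finset.card_union_of_disjoint (hb.disjoint hmcls)] at hgt'
    obtain ⟨A, haA, hAm, hAc⟩ := Finset.exists_subsuperset_card_eq
      (Finset.subset_union_left : a ⊆ a ∪ m) (n := critN h - b.card) (by omega) (by omega)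
    have hAcls := hmcls.mono hAm
    have hAN : (b ∪ A).card = critN h := by
      rw [Finset.card_union_of_disjoint (hb.disjoint hAcls)]
      omega
    have hmem : ∀ x ∈ a ∪ m, x ∉ a → 8 - 2 * h - 4 * (nb b x : ℝ) < 0 := by
      intro x hx hxa
      rcases Finset.mem_union.1 hx with hx | hx
      · exact absurd hx hxa
      · exact theta_neg h0 (mem_drift.1 hx).2
    have e1 := Hn_extend hL h hb hAcls haA
    have hs1 : ∑ x ∈ A \ a, (8 - 2 * h - 4 * (nb b x : ℝ)) ≤ 0 :=
      Finset.sum_nonpos fun x hx =>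
        (hmem x (hAm (Finset.mem_sdiff.1 hx).1) (Finset.mem_sdiff.1 hx).2).le
    rw [Finset.union_comm b a] at e1
    obtain ⟨-, hqH⟩ := isQuasiSq_of_le h0 h1 (by omega) hAN (by linarith)
    obtain ⟨y, hym, hyA⟩ : ∃ y ∈ a ∪ m, y ∉ A := by
      refine Finset.not_subset.1 fun hs => ?_
      have := Finset.card_le_card hs
      omega
    have hyb : y ∉ b := fun hyb => Finset.disjoint_left.1 (hb.disjoint hmcls) hyb hym
    have hyR : y ∉ b ∪ A := by simp [hyb, hyA]
    have hcard : (b ∪ insert y A).card = critN h + 1 := by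
      rw [Finset.union_insert, Finset.card_insert_of_notMem hyR, hAN]
    have hge := Gam_le_of_card h0 h1 hLN hcard
    rw [Finset.union_insert, Hn_insert (two_le_of_even hL) h hyR, hqH,
      nb_union_cls hL hAcls (hmcls y hym)] at hge
    have := hmem y hym fun hya => hyA (haA hya)
    linarith

end

section

variable {L : ℕ}

/-- The `k`-th site in the row by row enumeration of a strip of width `l` with corner `c`. -/
def stripSite (c : Site L) (l k : ℕ) : Site L := c + (((k % l : ℕ) : ZMod L), ((k / l : ℕ) : ZMod L))

/-- The first `m` sites of a strip. -/
noncomputable def strip (c : Site L) (l m : ℕ) : Finset (Site L) :=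
  (Finset.range m).image (stripSite c l)

lemma stripSite_eq (c : Site L) {l i : ℕ} (j : ℕ) (hi : i < l) :
    stripSite c l (l * j + i) = c + ((i : ZMod L), (j : ZMod L)) := by
  have e1 : (l * j + i) % l = i := by rw [Nat.mul_add_mod, Nat.mod_eq_of_lt hi]
  have e2 : (l * j + i) / l = j := by
    rw [Nat.mul_add_div (by omega), Nat.div_eq_of_lt hi, add_zero]
  rw [stripSite, e1, e2]

lemma stripSite_zero (c : Site L) (l : ℕ) : stripSite c l 0 = c := by
  refine Prod.ext ?_ ?_ <;> simp [stripSite]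

@[simp] lemma strip_zero (c : Site L) (l : ℕ) : strip c l 0 = ∅ := by simp [strip]

lemma strip_succ (c : Site L) (l m : ℕ) :
    strip c l (m + 1) = insert (stripSite c l m) (strip c l m) := by
  rw [strip, Finset.range_add_one, Finset.image_insert, strip]

lemma mem_strip_of_lt (c : Site L) (l : ℕ) {k m : ℕ} (hk : k < m) :
    stripSite c l k ∈ strip c l m :=
  Finset.mem_image_of_mem _ (Finset.mem_range.2 hk)

lemma mem_strip_iff (c : Site L) {l r : ℕ} (hl : 0 < l) (x : Site L) :
    x ∈ strip c l (l * r) ↔ x ∈ rect c l r := by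
  constructor
  · intro hx
    obtain ⟨k, hk, rfl⟩ := Finset.mem_image.1 hx
    exact ⟨k % l, k / l, Nat.mod_lt _ hl, Nat.div_lt_of_lt_mul (Finset.mem_range.1 hk), rfl⟩
  · rintro ⟨i, j, hi, hj, rfl⟩
    rw [← stripSite_eq c j hi]
    refine mem_strip_of_lt c l ?_
    calc l * j + i < l * (j + 1) := by rw [mul_add, mul_one]; omega
      _ ≤ l * r := Nat.mul_le_mul_left _ hj

lemma strip_card_le (c : Site L) (l m : ℕ) : (strip c l m).card ≤ m :=
  Finset.card_image_le.trans_eq (Finset.card_range m)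

lemma one_le_nb_of_mem {ω : Finset (Site L)} {x y : Site L} (hy : y ∈ ω) (hxy : Adj x y) :
    1 ≤ nb ω x :=
  nb_pos_iff.2 ⟨y, hy, hxy⟩

lemma two_le_nb {ω : Finset (Site L)} {x : Site L} (h1 : x - east L ∈ ω) (h2 : x - north L ∈ ω) :
    2 ≤ nb ω x := by
  simp only [nb, h1, h2, if_true]
  omega

lemma stripSite_sub_east (c : Site L) {l i : ℕ} (j : ℕ) (hi : i + 1 < l) :
    stripSite c l (l * j + (i + 1)) - east L = stripSite c l (l * j + i) := by
  rw [stripSite_eq c j hi, stripSite_eq c j (by omega)]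
  refine Prod.ext ?_ (by simp [east])
  simp only [Prod.fst_sub, Prod.fst_add, east, Nat.cast_succ]
  ring

lemma stripSite_sub_north (c : Site L) {l i : ℕ} (j : ℕ) (hi : i < l) :
    stripSite c l (l * (j + 1) + i) - north L = stripSite c l (l * j + i) := by
  rw [stripSite_eq c (j + 1) hi, stripSite_eq c j hi]
  refine Prod.ext (by simp [north]) ?_
  simp only [Prod.snd_sub, Prod.snd_add, north, Nat.cast_succ]
  ring

lemma stripSite_notMem (c : Site L) {l m : ℕ} (hl : 0 < l) (hlL : l ≤ L) (hm : m < l * L) :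
    stripSite c l m ∉ strip c l m := by
  intro hmem
  obtain ⟨k, hk, hkm⟩ := Finset.mem_image.1 hmem
  have hk' := Finset.mem_range.1 hk
  have h0 := add_left_cancel hkm
  have h1 := congrArg ZMod.val (Prod.ext_iff.1 h0).1
  have h2 := congrArg ZMod.val (Prod.ext_iff.1 h0).2
  simp only at h1 h2
  rw [ZMod.val_natCast_of_lt ((Nat.mod_lt _ hl).trans_le hlL),
    ZMod.val_natCast_of_lt ((Nat.mod_lt _ hl).trans_le hlL)] at h1
  rw [ZMod.val_natCast_of_lt (Nat.div_lt_of_lt_mul (hk'.trans hm)),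
    ZMod.val_natCast_of_lt (Nat.div_lt_of_lt_mul hm)] at h2
  have h3 := Nat.div_add_mod k l
  have h4 := Nat.div_add_mod m l
  rw [h1, h2, h4] at h3
  omega

lemma Hn_strip_succ_le (hL : 2 ≤ L) (h : ℝ) (c : Site L) {l m n : ℕ} (hl : 0 < l) (hlL : l ≤ L)
    (hm : m < l * L) (hn : n ≤ nb (strip c l m) (stripSite c l m)) :
    Hn h (strip c l (m + 1)) ≤ Hn h (strip c l m) + (8 - 2 * h - 4 * (n : ℝ)) := by
  rw [strip_succ, Hn_insert hL h (stripSite_notMem c hl hlL hm)]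
  have : (n : ℝ) ≤ nb (strip c l m) (stripSite c l m) := by exact_mod_cast hn
  linarith

lemma Hn_strip_le (hL : 2 ≤ L) (h : ℝ) (c : Site L) {l : ℕ} (hlL : l ≤ L) (j : ℕ) :
    ∀ i, 1 ≤ i → i ≤ l → l * j + i ≤ l * L →
      Hn h (strip c l (l * j + i)) ≤ 4 * (l : ℝ) + 4 - (2 * h * l - 4) * (j : ℝ) - 2 * h * (i : ℝ)
        - (if j = 0 then 4 * ((l : ℝ) - i) else 0) := by
  induction j with
  | zero =>
    intro i hi
    induction i, hi using Nat.le_induction with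
    | base =>
      intro hl hm
      have := Hn_strip_succ_le hL h c (l := l) (m := l * 0) (n := 0) (by omega) hlL (by omega)
        (Nat.zero_le _)
      rw [Nat.mul_zero, strip_zero, Hn_empty] at this
      rw [Nat.mul_zero]
      push_cast at this ⊢
      linarith
    | succ i hi ih =>
      intro hl hm
      obtain ⟨k, rfl⟩ : ∃ k, i = k + 1 := ⟨i - 1, by omega⟩
      have hmem : stripSite c l (l * 0 + (k + 1)) - east L ∈ strip c l (l * 0 + (k + 1)) := by
        rw [stripSite_sub_east c 0 (by omega)]
        exact mem_strip_of_lt c l (by omega)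
      have h1 := Hn_strip_succ_le hL h c (l := l) (m := l * 0 + (k + 1)) (n := 1) (by omega) hlL
        (by omega) (one_le_nb_of_mem hmem (Or.inr (Or.inl rfl)))
      have h2 := ih (by omega) (by omega)
      rw [← add_assoc (l * 0)]
      push_cast at h1 h2 ⊢
      linarith
  | succ j ihj =>
    intro i hi
    induction i, hi using Nat.le_induction with
    | base =>
      intro hl hm
      have hmem : stripSite c l (l * (j + 1)) - north L ∈ strip c l (l * (j + 1)) := by
        have := stripSite_sub_north c j (i := 0) (l := l) (by omega)
        rw [add_zero] at this
        rw [this]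
        exact mem_strip_of_lt c l (by rw [mul_add]; omega)
      have h1 := Hn_strip_succ_le hL h c (l := l) (m := l * (j + 1)) (n := 1) (by omega) hlL
        (by omega) (one_le_nb_of_mem hmem (Or.inr (Or.inr (Or.inr rfl))))
      have h2 := ihj l (by omega) le_rfl (by rw [mul_add] at hm; omega)
      have e : l * (j + 1) = l * j + l := by ring
      rw [← e] at h2
      have h3 : (0 : ℝ) ≤ if j = 0 then 4 * ((l : ℝ) - l) else 0 := by simp
      rw [if_neg (Nat.succ_ne_zero j)]
      push_cast at h1 h2 h3 ⊢
      linarith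
    | succ i hi ih =>
      intro hl hm
      obtain ⟨k, rfl⟩ : ∃ k, i = k + 1 := ⟨i - 1, by omega⟩
      have hm1 : stripSite c l (l * (j + 1) + (k + 1)) - east L ∈
          strip c l (l * (j + 1) + (k + 1)) := by
        rw [stripSite_sub_east c (j + 1) (by omega)]
        exact mem_strip_of_lt c l (by omega)
      have hm2 : stripSite c l (l * (j + 1) + (k + 1)) - north L ∈
          strip c l (l * (j + 1) + (k + 1)) := by
        rw [stripSite_sub_north c j (by omega)]
        exact mem_strip_of_lt c l (by rw [mul_add]; omega)
      have h1 := Hn_strip_succ_le hL h c (l := l) (m := l * (j + 1) + (k + 1)) (n := 2) (by omega) hlL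
        (by omega) (two_le_nb hm1 hm2)
      have h2 := ih (by omega) (by omega)
      rw [← add_assoc (l * (j + 1))]
      rw [if_neg (Nat.succ_ne_zero j)] at h2 ⊢
      push_cast at h1 h2 ⊢
      linarith

/-- Decomposition of a positive integer into complete rows and a non-empty last row. -/
lemma exists_row_decomp {l m : ℕ} (hl : 0 < l) (hm : 0 < m) :
    ∃ j i, 1 ≤ i ∧ i ≤ l ∧ m = l * j + i := by
  refine ⟨(m - 1) / l, (m - 1) % l + 1, by omega, Nat.mod_lt _ hl, ?_⟩
  have := Nat.div_add_mod (m - 1) l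
  omega

lemma Gam_lower {h : ℝ} (h0 : 0 < h) (h1 : h < 1) : 4 * (lam h : ℝ) - 2 * h ≤ Gam h := by
  obtain ⟨h3, -, h2⟩ := lam_facts h0 h1
  rw [Gam_eq h0 h1, critN_cast h0 h1]
  have : (0 : ℝ) ≤ lam h := (lam h).cast_nonneg
  nlinarith

lemma Gam_pos {h : ℝ} (h0 : 0 < h) (h1 : h < 1) : 10 < Gam h := by
  have h3 : (3 : ℝ) ≤ lam h := by exact_mod_cast (lam_facts h0 h1).1
  linarith [Gam_lower h0 h1]

/-- The canonical nucleation path stays below the protocritical height. -/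
lemma Hn_nucleation_le {h : ℝ} (h0 : 0 < h) (h1 : h < 1) (hL : critN h + 1 < L) (c : Site L) {m : ℕ}
    (hm : m ≤ critN h + 1) : Hn h (strip c (lam h - 1) m) ≤ Gam h := by
  obtain ⟨h3, -, h2⟩ := lam_facts h0 h1
  rcases Nat.eq_zero_or_pos m with rfl | hm0
  · rw [strip_zero, Hn_empty]
    linarith [Gam_pos h0 h1]
  obtain ⟨j, i, hi, hil, rfl⟩ := exists_row_decomp (l := lam h - 1) (by omega) hm0
  have hN : critN h = (lam h - 1) * lam h := by unfold critN; ring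
  have hle : lam h ≤ critN h := by
    rw [hN]; exact Nat.le_mul_of_pos_left _ (by omega)
  have hj : j ≤ lam h := by
    by_contra hlt
    have : (lam h - 1) * (lam h + 1) ≤ (lam h - 1) * j := Nat.mul_le_mul_left _ (by omega)
    rw [mul_add] at this
    omega
  have hb := Hn_strip_le (by omega) h c (l := lam h - 1) (by omega) j i hi hil
    (by
      have : (lam h - 1) * (lam h + 1) ≤ (lam h - 1) * L := Nat.mul_le_mul_left _ (by omega)
      rw [mul_add] at this
      omega)
  have hif : (0 : ℝ) ≤ if j = 0 then 4 * (((lam h - 1 : ℕ) : ℝ) - i) else 0 := by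
    split_ifs
    · have : (i : ℝ) ≤ ((lam h - 1 : ℕ) : ℝ) := by exact_mod_cast hil
      linarith
    · exact le_rfl
  have hi' : (1 : ℝ) ≤ i := by exact_mod_cast hi
  have hj' : (j : ℝ) ≤ lam h := by exact_mod_cast hj
  have hc : ((lam h - 1 : ℕ) : ℝ) = (lam h : ℝ) - 1 := by
    rw [Nat.cast_sub (by omega), Nat.cast_one]
  rw [hc] at hb hif
  rw [Gam_eq h0 h1, critN_cast h0 h1]
  nlinarith [mul_nonneg (sub_nonneg.2 hj') (show 0 ≤ 4 - 2 * h * ((lam h : ℝ) - 1) by linarith),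
    mul_nonneg h0.le (sub_nonneg.2 hi')]

variable [NeZero L]

lemma Hn_lower_of_subset_strip {h : ℝ} (h0 : 0 < h) (h1 : h < 1) {c : Site L} {r : ℕ}
    (hL : lam h * r < L) {S : Finset (Site L)} (hS : S.Nonempty)
    (hsub : S ⊆ strip c (lam h) (lam h * r)) :
    8 - 2 * h ≤ Hn h S ∨ 4 * (lam h : ℝ) - (2 * h * lam h - 4) * (r : ℝ) ≤ Hn h S := by
  obtain ⟨h3, hgt, h2⟩ := lam_facts h0 h1
  have hcard : S.card < L :=
    ((Finset.card_le_card hsub).trans (strip_card_le _ _ _)).trans_lt hL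
  have hp := card_fst_le hcard
  have hq := card_snd_le hcard
  have hpq := Finset.card_le_card (subset_product S)
  rw [Finset.card_product] at hpq
  have hp1 : 1 ≤ (S.image Prod.fst).card := (hS.image _).card_pos
  have hq1 : 1 ≤ (S.image Prod.snd).card := (hS.image _).card_pos
  have hpl : (S.image Prod.fst).card ≤ lam h := by
    have : S.image Prod.fst ⊆ (Finset.range (lam h)).image fun i : ℕ => c.1 + (i : ZMod L) := by
      intro z hz
      obtain ⟨x, hx, rfl⟩ := Finset.mem_image.1 hz
      obtain ⟨i, j, hi, hj, rfl⟩ := (mem_strip_iff c (by omega) x).1 (hsub hx)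
      exact Finset.mem_image.2 ⟨i, Finset.mem_range.2 hi, rfl⟩
    exact (Finset.card_le_card this).trans (Finset.card_image_le.trans_eq (Finset.card_range _))
  have hqr : (S.image Prod.snd).card ≤ r := by
    have : S.image Prod.snd ⊆ (Finset.range r).image fun i : ℕ => c.2 + (i : ZMod L) := by
      intro z hz
      obtain ⟨x, hx, rfl⟩ := Finset.mem_image.1 hz
      obtain ⟨i, j, hi, hj, rfl⟩ := (mem_strip_iff c (by omega) x).1 (hsub hx)
      exact Finset.mem_image.2 ⟨j, Finset.mem_range.2 hj, rfl⟩
    exact (Finset.card_le_card this).trans (Finset.card_image_le.trans_eq (Finset.card_range _))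
  generalize (S.image Prod.fst).card = p at *
  generalize (S.image Prod.snd).card = q at *
  have hH : 4 * ((p : ℝ) + q) - 2 * h * (p * q) ≤ Hn h S := by
    have e1 : (p : ℝ) ≤ bd S (north L) := by exact_mod_cast hp
    have e2 : (q : ℝ) ≤ bd S (east L) := by exact_mod_cast hq
    have e3 : (S.card : ℝ) ≤ p * q := by exact_mod_cast hpq
    unfold Hn
    nlinarith
  have f1 : (1 : ℝ) ≤ p := by exact_mod_cast hp1
  have f2 : (1 : ℝ) ≤ q := by exact_mod_cast hq1
  have f3 : (p : ℝ) ≤ lam h := by exact_mod_cast hpl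
  have f4 : (q : ℝ) ≤ r := by exact_mod_cast hqr
  rcases le_or_gt (2 * h * (q : ℝ)) 4 with hq4 | hq4
  · left
    refine le_trans ?_ hH
    nlinarith [mul_nonneg (sub_nonneg.2 f1) (sub_nonneg.2 hq4)]
  · right
    refine le_trans ?_ hH
    nlinarith [mul_nonneg (sub_nonneg.2 f3) (sub_nonneg.2 hq4.le),
      mul_nonneg (sub_nonneg.2 f4) (show 0 ≤ 2 * h * (lam h : ℝ) - 4 by linarith)]

lemma Hn_union_strip_lt {h : ℝ} (h0 : 0 < h) (h1 : h < 1) {c : Site L} {b m : ℕ}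
    (hL : lam h * b < L) {ω : Finset (Site L)} (hc : c ∈ ω) (hm : m ≤ lam h * b) :
    Hn h (ω ∪ strip c (lam h) m) < Hn h ω + Gam h := by
  obtain ⟨h3, hgt, h2⟩ := lam_facts h0 h1
  have hG := Gam_pos h0 h1
  have hG' := Gam_lower h0 h1
  rcases Nat.eq_zero_or_pos m with rfl | hm0
  · rw [strip_zero, Finset.union_empty]
    linarith
  obtain ⟨j, i, hi, hil, rfl⟩ := exists_row_decomp (l := lam h) (by omega) hm0
  have hb1 : 1 ≤ b := by
    by_contra hb
    have : b = 0 := by omega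
    rw [this] at hm
    omega
  have hlL : lam h ≤ L := (Nat.le_mul_of_pos_right _ hb1).trans hL.le
  have hjb : j + 1 ≤ b := by
    by_contra hlt
    have : lam h * b ≤ lam h * j := Nat.mul_le_mul_left _ (by omega)
    omega
  have hup := Hn_strip_le (by omega) h c (l := lam h) hlL j i hi hil
    (hm.trans (Nat.mul_le_mul_left _ (by
      have : b ≤ lam h * b := Nat.le_mul_of_pos_left _ (by omega)
      omega)))
  have hif : (0 : ℝ) ≤ if j = 0 then 4 * ((lam h : ℝ) - i) else 0 := by
    split_ifs
    · have : (i : ℝ) ≤ lam h := by exact_mod_cast hil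
      linarith
    · exact le_rfl
  have hsub : strip c (lam h) (lam h * j + i) ⊆ strip c (lam h) (lam h * (j + 1)) :=
    Finset.image_subset_image (Finset.range_subset_range.2 (by rw [mul_add]; omega))
  have hcm : c ∈ strip c (lam h) (lam h * j + i) := by
    have := mem_strip_of_lt c (lam h) hm0
    rwa [stripSite_zero] at this
  have hlow := Hn_lower_of_subset_strip h0 h1 (c := c) (r := j + 1)
    ((Nat.mul_le_mul_left _ hjb).trans_lt hL) ⟨c, Finset.mem_inter.2 ⟨hc, hcm⟩⟩
    (Finset.inter_subset_right.trans hsub : ω ∩ strip c (lam h) (lam h * j + i) ⊆ _)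
  have hsm := Hn_submod h ω (strip c (lam h) (lam h * j + i))
  have hi' : (1 : ℝ) ≤ i := by exact_mod_cast hi
  have hj0 : (0 : ℝ) ≤ j := j.cast_nonneg
  have hpr : 0 ≤ (2 * h * (lam h : ℝ) - 4) * (j : ℝ) := mul_nonneg (by linarith) hj0
  rcases hlow with hlow | hlow
  · nlinarith
  · push_cast at hlow
    nlinarith

lemma Hn_union_strip_le {h : ℝ} (h0 : 0 < h) (h1 : h < 1) {c : Site L} {b : ℕ}
    (hL : lam h * b < L) (hb : 4 * (lam h : ℝ) - (2 * h * lam h - 4) * (b : ℝ) ≤ 0)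
    {ω : Finset (Site L)} (hc : c ∈ ω) :
    Hn h (ω ∪ strip c (lam h) (lam h * b)) ≤ Hn h ω := by
  obtain ⟨h3, hgt, h2⟩ := lam_facts h0 h1
  obtain ⟨k, rfl⟩ : ∃ k, b = k + 1 := by
    refine ⟨b - 1, ?_⟩
    rcases Nat.eq_zero_or_pos b with rfl | hb0
    · have : (3 : ℝ) ≤ lam h := by exact_mod_cast h3
      simp at hb
      linarith
    · omega
  have hlL : lam h ≤ L := (Nat.le_mul_of_pos_right _ (Nat.succ_pos k)).trans hL.le
  have hup := Hn_strip_le (by omega) h c (l := lam h) hlL k (lam h) (by omega) le_rfl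
    (by
      have : lam h * k + lam h = lam h * (k + 1) := by ring
      rw [this]
      refine Nat.mul_le_mul_left _ ?_
      have : k + 1 ≤ lam h * (k + 1) := Nat.le_mul_of_pos_left _ (by omega)
      omega)
  have e : lam h * k + lam h = lam h * (k + 1) := by ring
  rw [e] at hup
  have hif : (0 : ℝ) ≤ if k = 0 then 4 * ((lam h : ℝ) - (lam h : ℝ)) else 0 := by simp
  have hcm : c ∈ strip c (lam h) (lam h * (k + 1)) := by
    have := mem_strip_of_lt c (lam h) (show 0 < lam h * (k + 1) from Nat.mul_pos (by omega) (by omega))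
    rwa [stripSite_zero] at this
  have hlow := Hn_lower_of_subset_strip h0 h1 (c := c) hL ⟨c, Finset.mem_inter.2 ⟨hc, hcm⟩⟩
    (Finset.inter_subset_right : ω ∩ strip c (lam h) (lam h * (k + 1)) ⊆ _)
  have hsm := Hn_submod h ω (strip c (lam h) (lam h * (k + 1)))
  push_cast at hb hlow
  rcases hlow with hlow | hlow <;> nlinarith

/-- Adding one site, below the level `X`. -/
def AddStep (h X : ℝ) (ω ω' : Finset (Site L)) : Prop :=
  ∃ x, ω' = insert x ω ∧ Hn h ω < X ∧ Hn h ω' < X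

lemma exists_boundary {ω : Finset (Site L)} (hne : ω.Nonempty) (hun : ω ≠ Finset.univ) :
    ∃ c ∈ ω, c + east L ∉ ω ∨ c + north L ∉ ω := by
  by_contra! hall
  obtain ⟨c, hc⟩ := hne
  have h1 : ∀ i : ℕ, c + ((i : ZMod L), 0) ∈ ω := by
    intro i
    induction i with
    | zero => rwa [Nat.cast_zero, show ((0 : ZMod L), (0 : ZMod L)) = 0 from rfl, add_zero]
    | succ i ih =>
      have := (hall _ ih).1
      rw [add_assoc] at this
      simpa [east] using this
  have h2 : ∀ i j : ℕ, c + ((i : ZMod L), (j : ZMod L)) ∈ ω := by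
    intro i j
    induction j with
    | zero => simpa using h1 i
    | succ j ih =>
      have := (hall _ ih).2
      rw [add_assoc] at this
      simpa [north] using this
  refine hun (Finset.eq_univ_of_forall fun x => ?_)
  have := h2 (x.1 - c.1).val (x.2 - c.2).val
  have e : c + (((x.1 - c.1).val : ZMod L), ((x.2 - c.2).val : ZMod L)) = x := by
    refine Prod.ext ?_ ?_ <;> simp
  rwa [e] at this

/-- Every non-empty droplet can grow to the full torus without climbing by `Γ`. -/
lemma exists_growth {h : ℝ} (h0 : 0 < h) (h1 : h < 1) {b : ℕ} (hb2 : 2 ≤ b)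
    (hL : lam h * b < L) (hb : 4 * (lam h : ℝ) - (2 * h * lam h - 4) * (b : ℝ) ≤ 0)
    (n : ℕ) : ∀ ω : Finset (Site L), ω.Nonempty → n + ω.card = Fintype.card (Site L) →
      ∀ X, Hn h ω + Gam h ≤ X → Relation.ReflTransGen (AddStep h X) ω Finset.univ := by
  obtain ⟨h3, -, -⟩ := lam_facts h0 h1
  induction n using Nat.strong_induction_on with
  | _ n ih =>
    intro ω hne hn X hX
    by_cases hun : ω = Finset.univ
    · rw [hun]
    obtain ⟨c, hc, hcb⟩ := exists_boundary hne hun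
    have hpath : ∀ m ≤ lam h * b,
        Relation.ReflTransGen (AddStep h X) ω (ω ∪ strip c (lam h) m) := by
      intro m
      induction m with
      | zero => intro _; simpa using Relation.ReflTransGen.refl
      | succ m ihm =>
        intro hm
        refine (ihm (by omega)).tail ⟨stripSite c (lam h) m, ?_, ?_, ?_⟩
        · rw [strip_succ, Finset.union_insert]
        · exact (Hn_union_strip_lt h0 h1 hL hc (by omega)).trans_le hX
        · exact (Hn_union_strip_lt h0 h1 hL hc hm).trans_le hX
    have hlt : ω.card < (ω ∪ strip c (lam h) (lam h * b)).card := by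
      refine Finset.card_lt_card (Finset.ssubset_iff_of_subset Finset.subset_union_left |>.2 ?_)
      rcases hcb with hcb | hcb
      · refine ⟨_, Finset.mem_union_right _ ?_, hcb⟩
        rw [mem_strip_iff c (by omega)]
        exact ⟨1, 0, by omega, by omega, by simp [east]⟩
      · refine ⟨_, Finset.mem_union_right _ ?_, hcb⟩
        rw [mem_strip_iff c (by omega)]
        exact ⟨0, 1, by omega, by omega, by simp [north]⟩
    have hle := Finset.card_le_univ (ω ∪ strip c (lam h) (lam h * b))
    refine (hpath _ le_rfl).trans (ih (Fintype.card (Site L) -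
      (ω ∪ strip c (lam h) (lam h * b)).card) (by omega) _ (hne.mono Finset.subset_union_left)
      (by omega) X ?_)
    linarith [Hn_union_strip_le h0 h1 hL hb hc]

end

section

variable {L : ℕ}

/-- Configurations of one of the two sublattices, given by the parity `p`. -/
abbrev HState (L : ℕ) := Σ p : Bool, ({x : Site L // chessE L x = p} → Bool)

/-- Extension of a half configuration by minus spins. -/
def HState.ext (s : HState L) : Config L :=
  fun x => if hx : chessE L x = s.1 then s.2 ⟨x, hx⟩ else false

/-- Restriction of a configuration to a sublattice. -/
def res (p : Bool) (σ : Config L) : HState L := ⟨p, fun x => σ x⟩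

@[simp] lemma res_fst (p : Bool) (σ : Config L) : (res p σ).1 = p := rfl

lemma ext_res (p : Bool) (σ : Config L) (x : Site L) :
    (res p σ).ext x = if chessE L x = p then σ x else false := by
  unfold HState.ext res
  split_ifs <;> rfl

lemma res_ext (s : HState L) : res s.1 s.ext = s := by
  obtain ⟨p, a⟩ := s
  unfold res
  congr 1
  funext x
  simp [HState.ext, x.2]

/-- The half configuration with a given set of plus spins. -/
def hst (p : Bool) (a : Finset (Site L)) : HState L := res p fun x => decide (x ∈ a)

@[simp] lemma hst_fst (p : Bool) (a : Finset (Site L)) : (hst p a).1 = p := rfl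

variable [NeZero L]

/-- The set of plus spins of a configuration. -/
def pl (σ : Config L) : Finset (Site L) := Finset.univ.filter fun x => σ x = true

lemma mem_pl {σ : Config L} {x : Site L} : x ∈ pl σ ↔ σ x = true := by simp [pl]

lemma pl_injective : Function.Injective (pl (L := L)) := by
  intro σ η he
  funext x
  rw [Bool.eq_iff_iff, ← mem_pl, ← mem_pl, he]

/-- The set of plus spins of a half configuration. -/
def HState.fs (s : HState L) : Finset (Site L) := pl s.ext

lemma HState.fs_cls (s : HState L) : InCls s.1 s.fs := by
  intro x hx
  by_contra hne
  have := mem_pl.1 hx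
  simp [HState.ext, hne] at this

lemma fs_res (p : Bool) (σ : Config L) : (res p σ).fs = (pl σ).filter fun x => chessE L x = p := by
  ext x
  rw [HState.fs, mem_pl, ext_res, Finset.mem_filter, mem_pl]
  split_ifs with hx <;> simp [hx]

lemma HState.eq_of_fs {s t : HState L} (h1 : s.1 = t.1) (h2 : s.fs = t.fs) : s = t := by
  rw [← res_ext s, ← res_ext t, h1, pl_injective h2]

lemma pl_decide (a : Finset (Site L)) : pl (fun x => decide (x ∈ a)) = a := by
  ext x
  simp [mem_pl]

lemma fs_hst (p : Bool) (a : Finset (Site L)) : (hst p a).fs = a.filter fun x => chessE L x = p := by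
  rw [hst, fs_res, pl_decide]

lemma spin_add_one (b : Bool) : spin b + 1 = 2 * ((if b = true then 1 else 0 : ℕ) : ℝ) := by
  cases b <;> norm_num [spin]

lemma nnS_eq (σ : Config L) (x : Site L) : nnS σ x = 2 * (nb (pl σ) x : ℝ) - 4 := by
  unfold nnS nb
  simp only [mem_pl, Nat.cast_add, mul_add, ← spin_add_one]
  ring

lemma flipP_weight (β h : ℝ) (σ : Config L) (x : Site L) (a : Bool) :
    (1 + Real.exp (-β * (8 - 2 * h - 4 * (nb (pl σ) x : ℝ)))) * flipP β h σ x a =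
      if a = true then Real.exp (-β * (8 - 2 * h - 4 * (nb (pl σ) x : ℝ))) else 1 := by
  unfold flipP
  rw [nnS_eq]
  set u := β * (8 - 2 * h - 4 * (nb (pl σ) x : ℝ)) with hu
  have e0 : -β * (8 - 2 * h - 4 * (nb (pl σ) x : ℝ)) = -u := by rw [hu]; ring
  have hp := Real.exp_pos (-u)
  cases a
  · have e1 : -2 * β * spin false * (2 * (nb (pl σ) x : ℝ) - 4 + h) = -u := by
      rw [hu]; simp only [spin, Bool.false_eq_true, if_false]; ring
    rw [e0, e1, if_neg (by simp), mul_one_div_cancel (by positivity)]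
  · have e1 : -2 * β * spin true * (2 * (nb (pl σ) x : ℝ) - 4 + h) = u := by
      rw [hu]; simp only [spin, if_true]; ring
    have hp' := Real.exp_pos u
    rw [e0, e1, if_pos rfl, mul_one_div, div_eq_iff (by positivity), mul_add, ← Real.exp_add]
    simp
    ring

/-- The transition matrix of the half chain, which alternates between the two sublattices. -/
noncomputable def Kh (β h : ℝ) (s t : HState L) : ℝ :=
  if t.1 = !s.1 then ∏ x : {x : Site L // chessE L x = t.1}, flipP β h s.ext x (t.2 x) else 0

/-- The conductances of the half chain. -/
noncomputable def ch (β h : ℝ) (s t : HState L) : ℝ :=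
  if t.1 = !s.1 then Real.exp (-β * Hn h (s.fs ∪ t.fs)) else 0

/-- The reversible measure of the half chain. -/
noncomputable def πh (β h : ℝ) (s : HState L) : ℝ :=
  Real.exp (-β * ((8 - 2 * h) * (s.fs.card : ℝ))) *
    ∏ x : {x : Site L // chessE L x = !s.1},
      (1 + Real.exp (-β * (8 - 2 * h - 4 * (nb s.fs x : ℝ))))

lemma isStoch_Kh (β h : ℝ) : IsStoch (Kh (L := L) β h) where
  nonneg s t := by
    unfold Kh
    split_ifs
    · exact Finset.prod_nonneg fun x _ => (flipP_pos _ _ _ _ _).le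
    · exact le_rfl
  sum_one s := by
    rw [Fintype.sum_sigma, Finset.sum_eq_single (!s.1)]
    · unfold Kh
      simp only [if_true]
      exact sum_prod_bool (fun (x : {x : Site L // chessE L x = !s.1}) a => flipP β h s.ext x a)
        fun x => flipP_add β h s.ext x
    · intro p _ hp
      exact Finset.sum_eq_zero fun a _ => if_neg hp
    · simp

lemma sum_fs (t : HState L) (g : Site L → ℝ) :
    ∑ x ∈ t.fs, g x = ∑ x : {x : Site L // chessE L x = t.1}, if t.2 x = true then g x else 0 := by
  have h1 : ∀ x, x ∈ t.fs ↔ chessE L x = t.1 ∧ t.ext x = true := fun x =>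
    ⟨fun hx => ⟨t.fs_cls x hx, mem_pl.1 hx⟩, fun hx => mem_pl.2 hx.2⟩
  have h2 : t.fs = (Finset.univ.filter fun x => chessE L x = t.1).filter fun x => t.ext x = true := by
    ext x
    simp [h1]
  rw [h2, Finset.sum_filter, Finset.sum_subtype (p := fun x => chessE L x = t.1) _ (by simp)]
  refine Finset.sum_congr rfl fun x _ => ?_
  simp [HState.ext, x.2]

lemma isRev_half (hL : Even L) (β h : ℝ) : IsRev (Kh (L := L) β h) (πh β h) (ch β h) where
  stoch := isStoch_Kh β h
  pos s := by
    unfold πh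
    exact mul_pos (Real.exp_pos _) (Finset.prod_pos fun x _ => by positivity)
  cond s t := by
    unfold Kh ch
    split_ifs with hst
    · have ht : InCls (!s.1) t.fs := hst ▸ t.fs_cls
      rw [Hn_union_cls hL h s.fs_cls ht, Hn_cls hL h s.fs_cls, mul_add, Real.exp_add, πh, mul_assoc,
        sum_fs, ← hst, ← Finset.prod_mul_distrib, Finset.mul_sum, Real.exp_sum]
      congr 1
      refine Finset.prod_congr rfl fun x _ => ?_
      rw [HState.fs, flipP_weight]
      split_ifs <;> simp
    · simp
  symm s t := by
    unfold ch
    rw [Finset.union_comm]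
    refine if_congr ?_ rfl rfl
    cases s.1 <;> cases t.1 <;> simp

end

section

variable {L : ℕ}

lemma config_ext_res {σ η : Config L} (p : Bool) (h1 : res p σ = res p η)
    (h2 : res (!p) σ = res (!p) η) : σ = η := by
  funext x
  have e1 := congrArg (fun s => s.ext x) h1
  have e2 := congrArg (fun s => s.ext x) h2
  simp only [ext_res] at e1 e2
  by_cases hx : chessE L x = p
  · simpa [hx] using e1
  · have hx' : chessE L x = !p := by
      cases p <;> simp_all
    simpa [hx'] using e2

variable [NeZero L]

lemma flipP_res (hL : Even L) (β h : ℝ) (σ : Config L) {p : Bool} {x : Site L}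
    (hx : chessE L x = !p) (a : Bool) : flipP β h (res p σ).ext x a = flipP β h σ x a := by
  have key : ∀ y, Adj x y → (res p σ).ext y = σ y := by
    intro y hy
    have hyc := hy.chess hL
    rw [hx, Bool.not_not] at hyc
    rw [ext_res, if_pos hyc]
  unfold flipP nnS
  rw [key _ (Or.inl rfl), key _ (Or.inr (Or.inl rfl)), key _ (Or.inr (Or.inr (Or.inl rfl))),
    key _ (Or.inr (Or.inr (Or.inr rfl)))]

lemma Kh_res (hL : Even L) (β h : ℝ) (σ η : Config L) (p : Bool) :
    Kh β h (res p σ) (res (!p) η) =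
      ∏ x : {x : Site L // chessE L x = !p}, flipP β h σ x (η x) := by
  unfold Kh
  rw [if_pos (by simp)]
  exact Finset.prod_congr rfl fun x _ => flipP_res hL β h σ x.2 _

lemma Pmat_eq (hL : Even L) (β h : ℝ) (σ η : Config L) :
    Pmat β h σ η = Kh β h (res true σ) (res false η) * Kh β h (res false σ) (res true η) := by
  have h1 := Kh_res hL β h σ η true
  have h2 := Kh_res hL β h σ η false
  simp only [Bool.not_true, Bool.not_false] at h1 h2
  rw [h1, h2, Pmat, ← Finset.prod_filter_mul_prod_filter_not Finset.univ fun x => chessE L x = false]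
  congr 1
  · exact Finset.prod_subtype _ (by simp) _
  · exact Finset.prod_subtype _ (by simp) _

/-- The energy of a transition of the full chain. -/
noncomputable def Hf (h : ℝ) (σ η : Config L) : ℝ :=
  Hn h ((res true σ).fs ∪ (res false η).fs) + Hn h ((res false σ).fs ∪ (res true η).fs)

lemma isRev_full (hL : Even L) (β h : ℝ) :
    IsRev (Pmat (L := L) β h) (fun σ => πh β h (res true σ) * πh β h (res false σ))
      (fun σ η => Real.exp (-β * Hf h σ η)) where
  stoch := isStoch_Pmat β h
  pos σ := mul_pos ((isRev_half hL β h).pos _) ((isRev_half hL β h).pos _)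
  cond σ η := by
    have h1 := (isRev_half hL β h).cond (res true σ) (res false η)
    have h2 := (isRev_half hL β h).cond (res false σ) (res true η)
    simp only [ch, res_fst, Bool.not_true, Bool.not_false, if_true] at h1 h2
    rw [Pmat_eq hL, Hf, mul_add, Real.exp_add, ← h1, ← h2]
    ring
  symm σ η := by
    unfold Hf
    rw [add_comm, Finset.union_comm, Finset.union_comm (res true σ).fs]

lemma res_eq_iff {p : Bool} {σ η : Config L} :
    res p σ = res p η ↔ (res p σ).fs = (res p η).fs :=
  ⟨fun he => by rw [he], fun he => HState.eq_of_fs rfl he⟩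

lemma mem_fs_res {p : Bool} {σ : Config L} {x : Site L} :
    x ∈ (res p σ).fs ↔ σ x = true ∧ chessE L x = p := by
  rw [fs_res, Finset.mem_filter, mem_pl]

lemma fs_union_res (σ : Config L) (p : Bool) : (res p σ).fs ∪ (res (!p) σ).fs = pl σ := by
  ext x
  simp only [Finset.mem_union, mem_fs_res, mem_pl]
  cases chessE L x <;> cases p <;> simp

/-- The sites of each parity are at least `L`. -/
lemma le_card_class (hL : Even L) (q : Bool) :
    L ≤ (Finset.univ.filter fun x : Site L => chessE L x = q).card := by
  have key : ∀ d : ZMod L, chessE L (0, d) = q →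
      L ≤ (Finset.univ.filter fun x : Site L => chessE L x = q).card := by
    intro d hd
    have hinj : Function.Injective fun u : ZMod L => ((u, d - u) : Site L) := fun u v huv =>
      (Prod.ext_iff.1 huv).1
    calc L = (Finset.univ.image fun u : ZMod L => ((u, d - u) : Site L)).card := by
          rw [Finset.card_image_of_injective _ hinj, Finset.card_univ, ZMod.card]
      _ ≤ _ := by
          refine Finset.card_le_card fun x hx => ?_
          obtain ⟨u, -, rfl⟩ := Finset.mem_image.1 hx
          rw [Finset.mem_filter]
          refine ⟨Finset.mem_univ _, ?_⟩
          rw [← hd]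
          simp [chessE]
  have h0 : chessE L (0, 0) = true := by simp [chessE]
  have h1 : chessE L (0, 1) = false := by
    have := chess_add_unit hL (x := (0, 0)) (d := (0, 1)) (by simp)
    rw [h0] at this
    simpa using this
  cases q
  · exact key 1 h1
  · exact key 0 h0

lemma card_pl_chess (hL : Even L) {C : Config L} (hC : C ∈ chessSet L) : L ≤ (pl C).card := by
  rcases hC with rfl | rfl
  · exact le_card_class hL true
  · refine (le_card_class hL false).trans_eq ?_
    unfold pl chessO
    simp

end

section

variable {L : ℕ}

lemma filter_union_filter_cls (ω : Finset (Site L)) (p : Bool) :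
    (ω.filter fun x => chessE L x = p) ∪ (ω.filter fun x => chessE L x = !p) = ω := by
  ext x
  simp only [Finset.mem_union, Finset.mem_filter]
  cases chessE L x <;> cases p <;> simp

variable [NeZero L]

lemma mem_protoSet (hL : Even L) {h : ℝ} {R : Finset (Site L)} {y : Site L} (hR : IsQuasiSq h R)
    (hy : y ∉ R) (hnb : 0 < nb R y) {σ : Config L}
    (hσ : pl σ = (insert y R).filter fun x => chessE L x = chessE L y) : σ ∈ ProtoSet h L := by
  obtain ⟨c, a, b, hab, hRm⟩ := hR
  obtain ⟨z, hz, hyz⟩ := nb_pos_iff.1 hnb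
  have hmem : ∀ x, σ x = true ↔ (x = y ∨ x ∈ rect c a b) ∧ chessE L x = chessE L y := by
    intro x
    rw [← mem_pl, hσ, Finset.mem_filter, Finset.mem_insert, hRm]
  set C : Config L := fun x => !(chessE L x == chessE L y) with hC
  have hchess : IsChessCfg C := by
    rcases hq : chessE L y with _ | _
    · left
      funext x
      simp [hC, hq]
    · right
      funext x
      simp [hC, hq, chessO]
  refine ⟨fun x => if x ∈ rect c a b then C x else false, c, a, b, C, y, z, hchess, hab,
    fun x hx => if_pos hx, fun x hx => if_neg hx, fun hyr => hy ((hRm y).2 hyr), (hRm z).1 hz, hyz,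
    ?_, fun x hx => ?_, (hmem y).2 ⟨Or.inl rfl, rfl⟩, fun x hx hxy => ?_⟩
  · simp [hC, hyz.chess hL]
  · rw [Bool.eq_iff_iff, hmem]
    simp [hC, hx]
  · rw [← Bool.not_eq_true, hmem]
    simp [hx, hxy]

lemma card_pl_le_of_protoSet {h : ℝ} {σ : Config L} (hσ : σ ∈ ProtoSet h L) :
    (pl σ).card ≤ critN h + 1 := by
  obtain ⟨-, c, a, b, C, y, z, -, hab, -, -, -, -, -, -, -, -, hout⟩ := hσ
  have hsub : pl σ ⊆ insert y ((Finset.range a ×ˢ Finset.range b).image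
      fun k : ℕ × ℕ => c + ((k.1 : ZMod L), (k.2 : ZMod L))) := by
    intro x hx
    rw [mem_pl] at hx
    by_cases hxy : x = y
    · simp [hxy]
    · by_contra hne
      have hxr : x ∉ rect c a b := by
        rintro ⟨i, j, hi, hj, rfl⟩
        refine hne (Finset.mem_insert_of_mem (Finset.mem_image.2 ⟨(i, j), ?_, rfl⟩))
        simp [hi, hj]
      simp [hout x hxr hxy] at hx
  refine (Finset.card_le_card hsub).trans ((Finset.card_insert_le _ _).trans ?_)
  refine Nat.add_le_add_right (Finset.card_image_le.trans ?_) 1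
  rw [Finset.card_product, Finset.card_range, Finset.card_range]
  unfold critN
  rcases hab with ⟨rfl, rfl⟩ | ⟨rfl, rfl⟩
  · rw [mul_comm]
  · exact le_rfl

/-- The well of the configuration `-1`. -/
def InnerCfg (h : ℝ) (σ : Config L) : Prop := ∀ p, Inner h p (res p σ).fs

lemma InnerCfg.card_le {h : ℝ} {σ : Config L} (hσ : InnerCfg h σ) :
    (pl σ).card ≤ 2 * critN h := by
  rw [← fs_union_res σ true]
  have h1 := (hσ true).card_le
  have h2 := (hσ (!true)).card_le
  have h3 := Finset.card_union_le (res true σ).fs (res (!true) σ).fs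
  omega

lemma InnerCfg.gate {h : ℝ} (h0 : 0 < h) (h1 : h < 1) (hL : Even L) (hLN : critN h + 1 < L)
    {σ η : Config L} (hσ : InnerCfg h σ) (hH : Hf h σ η ≤ Gam h) :
    InnerCfg h η ∨ η ∈ ProtoSet h L := by
  have key : ∀ p, Hn h ((res p σ).fs ∪ (res (!p) η).fs) +
      Hn h ((res (!p) σ).fs ∪ (res p η).fs) ≤ Gam h →
      Inner h (!p) (res (!p) η).fs ∨ η ∈ ProtoSet h L := by
    intro p hp
    have c1 : InCls p (res p σ).fs := (res p σ).fs_cls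
    have c2 : InCls (!p) (res (!p) η).fs := (res (!p) η).fs_cls
    have c3 : InCls (!p) (res (!p) σ).fs := (res (!p) σ).fs_cls
    have c4 : InCls (!(!p)) (res p η).fs := by
      rw [Bool.not_not]
      exact (res p η).fs_cls
    have n1 := (hσ p).Hn_nonneg h0 h1 hL hLN c1 c2
    have n2 := (hσ (!p)).Hn_nonneg h0 h1 hL hLN c3 c4
    rcases (hσ p).gate h0 h1 hL hLN c1 c2 (by linarith) with hI | ⟨hG, R, y, hR, hy, hyc, hnb, he⟩
    · exact Or.inl hI
    · right
      have hem := ((hσ (!p)).eq_empty h0 h1 hL hLN c3 c4 (by linarith)).2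
      refine mem_protoSet hL hR hy hnb ?_
      rw [← fs_union_res η p, hem, Finset.empty_union, ← he, Finset.filter_union, hyc,
        Finset.filter_true_of_mem c2, Finset.filter_false_of_mem, Finset.empty_union]
      intro x hx
      rw [c1 x hx]
      simp
  unfold Hf at hH
  rcases key true hH with hI | hQ
  · rcases key false (by simpa [add_comm] using hH) with hI' | hQ
    · left
      intro p
      cases p
      · exact hI
      · exact hI'
    · exact Or.inr hQ
  · exact Or.inr hQ

/-- A step of the half chain with a constraint on the set of plus spins involved. -/
def HStep (G : Finset (Site L) → Prop) (s t : HState L) : Prop := t.1 = !s.1 ∧ G (s.fs ∪ t.fs)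

lemma hStep_not {G : Finset (Site L) → Prop} {ω : Finset (Site L)} (hG : G ω) (p : Bool) :
    HStep G (hst p ω) (hst (!p) ω) := by
  refine ⟨rfl, ?_⟩
  rw [fs_hst, fs_hst, filter_union_filter_cls]
  exact hG

lemma reach_hst {G : Finset (Site L) → Prop} {ω : Finset (Site L)} (hG : G ω) (p q : Bool) :
    Relation.ReflTransGen (HStep G) (hst p ω) (hst q ω) := by
  rcases Bool.eq_or_eq_not q p with rfl | rfl
  · exact .refl
  · exact .single (hStep_not hG p)

lemma hst_insert {ω : Finset (Site L)} {x : Site L} {p : Bool} (hx : chessE L x = !p) :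
    hst p (insert x ω) = hst p ω := by
  refine HState.eq_of_fs rfl ?_
  rw [fs_hst, fs_hst, Finset.filter_insert, if_neg]
  rw [hx]
  simp

/-- Paths of droplets lift to paths of the half chain. -/
lemma reach_hst_of_reach {G : Finset (Site L) → Prop} {ω ω' : Finset (Site L)} (hG : G ω)
    (hr : Relation.ReflTransGen (fun ω ω' => ∃ x, ω' = insert x ω ∧ G ω ∧ G ω') ω ω') (p : Bool) :
    ∀ q, Relation.ReflTransGen (HStep G) (hst p ω) (hst q ω') := by
  induction hr with
  | refl => exact reach_hst hG p
  | @tail ω₁ ω₂ _ hs ih =>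
    intro q
    obtain ⟨x, rfl, -, hG2⟩ := hs
    have h1 := ih (!(chessE L x))
    rw [← hst_insert (x := x) (Bool.not_not _).symm] at h1
    exact h1.trans (reach_hst hG2 _ q)

end

section

variable {L : ℕ}

lemma ext_hst_empty (p : Bool) : (hst p (∅ : Finset (Site L))).ext = minusC L := by
  funext x
  simp [hst, ext_res, minusC]

variable [NeZero L]

lemma ext_hst_step (h : ℝ) {s t : HState L} (hst : t.1 = !s.1) :
    Hf h s.ext t.ext = Hn h (s.fs ∪ t.fs) := by
  have key : ∀ s : HState L, (res s.1 s.ext).fs = s.fs ∧ (res (!s.1) s.ext).fs = ∅ := by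
    intro s
    refine ⟨by rw [res_ext], ?_⟩
    rw [fs_res, Finset.filter_eq_empty_iff]
    intro x hx
    rw [s.fs_cls x hx]
    simp
  have k1 := key s
  have k2 := key t
  rw [hst] at k2
  unfold Hf
  rcases hs : s.1 with _ | _ <;> rw [hs] at k1 k2 <;>
    simp only [Bool.not_true, Bool.not_false] at k1 k2 <;> rw [k1.1, k1.2, k2.1, k2.2] <;> simp

lemma exists_nucleation {h : ℝ} (h0 : 0 < h) (h1 : h < 1) (hL : Even L) (hLN : critN h + 1 < L) :
    ∃ ζ ∈ ProtoSet h L, Relation.ReflTransGen (fun σ η => Hf h σ η ≤ Gam h) (minusC L) ζ := by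
  obtain ⟨h3, -, -⟩ := lam_facts h0 h1
  have hN : critN h = (lam h - 1) * lam h := by unfold critN; ring
  have hle : lam h ≤ critN h := by
    rw [hN]; exact Nat.le_mul_of_pos_left _ (by omega)
  have hpath : ∀ m ≤ critN h + 1, Relation.ReflTransGen
      (fun ω ω' => ∃ x, ω' = insert x ω ∧ Hn h ω ≤ Gam h ∧ Hn h ω' ≤ Gam h)
      ∅ (strip (0 : Site L) (lam h - 1) m) := by
    intro m
    induction m with
    | zero => intro _; rw [strip_zero]
    | succ m ih =>
      intro hm
      exact (ih (by omega)).tail ⟨_, strip_succ _ _ _, Hn_nucleation_le h0 h1 hLN 0 (by omega),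
        Hn_nucleation_le h0 h1 hLN 0 hm⟩
  have hG0 : Hn h (∅ : Finset (Site L)) ≤ Gam h := by
    rw [Hn_empty]; linarith [Gam_pos h0 h1]
  set y := stripSite (0 : Site L) (lam h - 1) (critN h) with hy
  have hr := reach_hst_of_reach (G := fun ω => Hn h ω ≤ Gam h) hG0 (hpath _ le_rfl) true (chessE L y)
  refine ⟨(hst (chessE L y) (strip (0 : Site L) (lam h - 1) (critN h + 1))).ext, ?_, ?_⟩
  · refine mem_protoSet hL (R := strip 0 (lam h - 1) (critN h)) (y := y)
      ⟨0, lam h - 1, lam h, Or.inl ⟨rfl, rfl⟩, fun x => ?_⟩ ?_ ?_ ?_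
    · rw [hN]
      exact mem_strip_iff _ (by omega) x
    · refine stripSite_notMem _ (by omega) (by omega) ?_
      rw [hN]
      exact Nat.mul_lt_mul_of_pos_left (by omega) (by omega)
    · refine nb_pos_iff.2 ⟨y - north L, ?_, Or.inr (Or.inr (Or.inr rfl))⟩
      have e : critN h = (lam h - 1) * ((lam h - 1) + 1) + 0 := by
        rw [hN, add_zero, Nat.sub_add_cancel (by omega)]
      rw [hy, e, stripSite_sub_north _ _ (by omega)]
      exact mem_strip_of_lt _ _ (by rw [mul_add]; omega)
    · rw [← strip_succ]
      exact fs_hst _ _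
  · rw [← ext_hst_empty true]
    refine hr.lift HState.ext fun s t hs => ?_
    exact (ext_hst_step h hs.1).trans_le hs.2

lemma innerCfg_minus (h : ℝ) : InnerCfg h (minusC L) := by
  intro p
  rw [fs_res]
  have : pl (minusC L) = ∅ := by
    ext x
    simp [mem_pl, minusC]
  rw [this, Finset.filter_empty]
  exact inner_empty h p

/-- The well of the all-minus configuration, without the protocritical droplets. -/
def wellMinus (h : ℝ) (L : ℕ) [NeZero L] : Set (Config L) :=
  {σ | σ ∉ ProtoSet h L ∧ InnerCfg h σ}

lemma card_pl_lt {h : ℝ} (hLN : 2 * critN h + 1 < L) {σ : Config L}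
    (hσ : σ ∈ wellMinus h L ∪ ProtoSet h L) : (pl σ).card < L := by
  rcases hσ with hσ | hσ
  · have := hσ.2.card_le
    omega
  · have := card_pl_le_of_protoSet hσ
    omega

/-- The total conductance out of the well, relative to the saddle. -/
noncomputable def leak (h : ℝ) (L : ℕ) [NeZero L] (β : ℝ) : ℝ :=
  ∑ x : Config L, ∑ y : Config L,
    if x ∈ wellMinus h L ∧ y ∉ wellMinus h L ∧ y ∉ ProtoSet h L then
      Real.exp (-β * (Hf h x y - Gam h)) else 0

lemma tendsto_exp_neg_mul {d : ℝ} (hd : 0 < d) :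
    Tendsto (fun β : ℝ => Real.exp (-β * d)) atTop (nhds 0) := by
  refine Real.tendsto_exp_atBot.comp ?_
  simp only [neg_mul]
  exact tendsto_neg_atTop_atBot.comp (tendsto_id.atTop_mul_const hd)

lemma gam_lt_of_exit {h : ℝ} (h0 : 0 < h) (h1 : h < 1) (hL : Even L) (hLN : critN h + 1 < L)
    {x y : Config L} (hx : x ∈ wellMinus h L) (hy : y ∉ wellMinus h L ∪ ProtoSet h L) :
    Gam h < Hf h x y := by
  by_contra hle
  refine hy ?_
  by_cases hyQ : y ∈ ProtoSet h L
  · exact Or.inr hyQ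
  · rcases hx.2.gate h0 h1 hL hLN (not_lt.1 hle) with hI | hQ
    · exact Or.inl ⟨hyQ, hI⟩
    · exact Or.inr hQ

lemma tendsto_leak {h : ℝ} (h0 : 0 < h) (h1 : h < 1) (hL : Even L) (hLN : critN h + 1 < L) :
    Tendsto (leak h L) atTop (nhds 0) := by
  have hzero : (0 : ℝ) = ∑ x : Config L, ∑ y : Config L, (0 : ℝ) := by simp
  rw [show nhds (0 : ℝ) = nhds (∑ x : Config L, ∑ y : Config L, (0 : ℝ)) from congrArg nhds hzero]
  refine tendsto_finsetSum _ fun x _ => tendsto_finsetSum _ fun y _ => ?_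
  split_ifs with hxy
  · refine tendsto_exp_neg_mul (sub_pos.2 (gam_lt_of_exit h0 h1 hL hLN hxy.1 ?_))
    rintro (hy | hy)
    · exact hxy.2.1 hy
    · exact hxy.2.2 hy
  · exact tendsto_const_nhds

theorem tendsto_protoSet {h : ℝ} (h0 : 0 < h) (h1 : h < 1) (hL : Even L)
    (hLN : 2 * critN h + 1 < L) :
    Tendsto (fun β : ℝ => probHitBefore β h (minusC L) (ProtoSet h L) (chessSet L))
      atTop (nhds 1) := by
  have hLN' : critN h + 1 < L := by omega
  set W := wellMinus h L with hW
  set Q := ProtoSet h L with hQ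
  obtain ⟨ζ, hζ, hpath⟩ := exists_nucleation h0 h1 hL hLN'
  have hm : minusC L ∈ W ∪ Q := by
    by_cases hq : minusC L ∈ Q
    · exact Or.inr hq
    · exact Or.inl ⟨hq, innerCfg_minus h⟩
  have hstep : ∀ x ∈ W, ∀ y, Hf h x y ≤ Gam h → y ∈ W ∪ Q := by
    intro x hx y hy
    by_contra hne
    exact absurd (gam_lt_of_exit h0 h1 hL hLN' hx hne) (not_lt.2 hy)
  have hbound : ∃ n : ℕ, ∀ (f : Config L → ℝ) (d : ℝ), 0 ≤ d → (∀ x ∈ Q, f x = 0) →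
      (∀ x ∈ W, ∀ y ∈ W ∪ Q, Hf h x y ≤ Gam h → |f x - f y| ≤ d) →
      |f (minusC L)| ≤ n * d := by
    rcases hm with hm | hm
    · obtain ⟨n, hn⟩ := exists_exit_bound hm hstep (fun hw => hw.1 hζ) hpath
      exact ⟨n, fun f d _ => hn f d⟩
    · refine ⟨0, fun f d _ hf _ => ?_⟩
      rw [hf _ hm]
      simp
  obtain ⟨n, hn⟩ := hbound
  have hlow : ∀ β : ℝ, 0 ≤ β → 1 - n * Real.sqrt (2 * leak h L β) ≤
      probHitBefore β h (minusC L) Q (chessSet L) ∧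
      probHitBefore β h (minusC L) Q (chessSet L) ≤ 1 := by
    intro β hβ
    have hP := isStoch_Pmat (L := L) β h
    have hesc : ∀ x ∈ W, ∃ z, z ∉ W ∧ 0 < Pmat β h x z := fun x _ =>
      ⟨ζ, fun hw => hw.1 hζ, Pmat_pos β h x ζ⟩
    obtain ⟨f, hf⟩ := hP.exists_dirichlet hesc fun x => if x ∈ W ∪ Q then 0 else 1
    have hfW : ∀ x ∈ W, f x = ∑ y, Pmat β h x y * f y := by
      intro x hx
      rw [hf x, if_pos (Set.mem_union_left _ hx), if_pos hx, zero_add]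
    have hfQ : ∀ x ∈ Q, f x = 0 := by
      intro x hx
      have hxW : x ∉ W := fun hw => hw.1 hx
      rw [hf x, if_pos (Set.mem_union_right _ hx), if_neg hxW, zero_add]
    have hfo : ∀ x, x ∉ W → x ∉ Q → f x = 1 := by
      intro x hx hx'
      rw [hf x, if_neg (by rintro (hh | hh) <;> contradiction), if_neg hx, add_zero]
    have hf0 : ∀ x, 0 ≤ f x := by
      refine hP.min_principle hesc (fun x hx => ?_) fun x hx => (hfW x hx).ge
      by_cases hxQ : x ∈ Q
      · exact (hfQ x hxQ).ge
      · rw [hfo x hx hxQ]; exact zero_le_one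
    have hf1 : ∀ x, f x ≤ 1 := by
      have := hP.min_principle (φ := fun x => 1 - f x) hesc (fun x hx => ?_) fun x hx => ?_
      · exact fun x => sub_nonneg.1 (this x)
      · by_cases hxQ : x ∈ Q
        · simp [hfQ x hxQ]
        · simp [hfo x hx hxQ]
      · simp only [mul_sub, mul_one, Finset.sum_sub_distrib, hP.sum_one]
        rw [← hfW x hx]
    have hchess : ∀ x ∈ chessSet L, x ∉ W ∧ x ∉ Q := by
      intro x hx
      have hc := card_pl_chess hL hx
      refine ⟨fun hw => ?_, fun hw => ?_⟩
      · exact absurd (card_pl_lt hLN (Or.inl hw)) (by omega)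
      · exact absurd (card_pl_lt hLN (Or.inr hw)) (by omega)
    have hs := one_sub_le_probHitBefore β h (minusC L) (A := Q) (B := chessSet L)
      ⟨_, Or.inl rfl⟩ hf0 (fun x hx => (hfo x (hchess x hx).1 (hchess x hx).2).ge)
      (fun x hxQ _ => by
        by_cases hxW : x ∈ W
        · exact (hfW x hxW).ge
        · rw [hfo x hxW hxQ]
          calc _ ≤ ∑ y, Pmat β h x y * 1 := Finset.sum_le_sum fun y _ =>
                mul_le_mul_of_nonneg_left (hf1 y) (Pmat_pos β h x y).le
            _ = 1 := by simp only [mul_one, hP.sum_one])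
    refine ⟨?_, hs.2⟩
    have hb := hn f (Real.sqrt (2 * leak h L β)) (Real.sqrt_nonneg _) hfQ fun x hx y hy hxy => by
      refine Real.abs_le_sqrt ?_
      have hε : ∑ x, ∑ y, (if x ∈ W ∧ y ∉ W ∧ y ∉ Q then Real.exp (-β * Hf h x y) else 0) ≤
          Real.exp (-β * Gam h) * leak h L β := by
        unfold leak
        simp only [Finset.mul_sum]
        refine Finset.sum_le_sum fun x _ => Finset.sum_le_sum fun y _ => ?_
        split_ifs
        · rw [← Real.exp_add]
          refine (congrArg Real.exp ?_).le
          ring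
        · simp
      have hedge := (isRev_full hL β h).exit_edge hf0 hf1 hfQ hfW hε hx hy
      have hexp : Real.exp (-β * Gam h) ≤ Real.exp (-β * Hf h x y) := by
        refine Real.exp_le_exp.2 ?_
        nlinarith
      have hpos := Real.exp_pos (-β * Gam h)
      have := (mul_le_mul_of_nonneg_right hexp (sq_nonneg (f x - f y))).trans hedge
      refine le_of_mul_le_mul_left (this.trans_eq ?_) hpos
      ring
    have := le_abs_self (f (minusC L))
    linarith [hs.1]
  have hlim : Tendsto (fun β : ℝ => 1 - n * Real.sqrt (2 * leak h L β)) atTop (nhds 1) := by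
    have h2 := (tendsto_leak h0 h1 hL hLN').const_mul 2
    rw [mul_zero] at h2
    have h3 := (Real.continuous_sqrt.tendsto 0).comp h2
    rw [Real.sqrt_zero] at h3
    have h4 := (h3.const_mul (n : ℝ)).const_sub 1
    rwa [mul_zero, sub_zero] at h4
  refine tendsto_of_tendsto_of_tendsto_of_le_of_le' hlim tendsto_const_nhds ?_ ?_
  · filter_upwards [eventually_ge_atTop 0] with β hβ using (hlow β hβ).1
  · filter_upwards [eventually_ge_atTop 0] with β hβ using (hlow β hβ).2

end

section

variable {L : ℕ} [NeZero L]

/-- The half configurations with only plus spins. -/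
def plusSet (L : ℕ) [NeZero L] : Set (HState L) := {s | s = hst s.1 Finset.univ}

lemma hst_univ_mem (p : Bool) : hst p Finset.univ ∈ plusSet L := rfl

lemma fs_hst_empty (p : Bool) : (hst p (∅ : Finset (Site L))).fs = ∅ := by
  rw [fs_hst, Finset.filter_empty]

lemma Kh_pos (β h : ℝ) {s t : HState L} (hst : t.1 = !s.1) : 0 < Kh β h s t := by
  unfold Kh
  rw [if_pos hst]
  exact Finset.prod_pos fun x _ => flipP_pos _ _ _ _ _

lemma one_le_πh (hL : Even L) (β h : ℝ) (p : Bool) : 1 ≤ πh β h (hst p (∅ : Finset (Site L))) := by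
  have hR := isRev_half hL β h
  rw [← hR.sum_cond]
  refine le_trans (le_of_eq ?_) (Finset.single_le_sum (f := fun t => ch β h (hst p ∅) t)
    (fun t _ => hR.cond_nonneg _ t) (Finset.mem_univ (hst (!p) ∅)))
  simp [ch, fs_hst_empty]

lemma killedLaw_plus_le {h : ℝ} (h0 : 0 < h) (h1 : h < 1) (hL : Even L) (hLN : critN h + 1 < L)
    {β : ℝ} (hβ : 0 ≤ β) (p q : Bool) (n : ℕ) :
    killedLaw (Kh β h) (plusSet L) (hst p ∅) n (hst q Finset.univ) ≤
      (Fintype.card (HState L) : ℝ) ^ 2 * Real.exp (-β * Gam h) := by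
  refine (isRev_half hL β h).killedLaw_flux (D := {s | Inner h s.1 s.fs}) ?_ ?_ (Real.exp_pos _).le
    ?_ (one_le_πh hL β h p) n (hst_univ_mem q)
  · rw [Set.mem_ofPred_eq, fs_hst_empty]
    exact inner_empty h p
  · intro s hs hI
    have hs' : s = hst s.1 Finset.univ := hs
    have h2 := Inner.card_le hI
    rw [hs', fs_hst] at h2
    have := le_card_class hL s.1
    omega
  · intro s hs t ht
    unfold ch
    split_ifs with hst
    · refine Real.exp_le_exp.2 ?_
      have hle : Gam h ≤ Hn h (s.fs ∪ t.fs) := by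
        by_contra! hlt
        have hs' : Inner h s.1 s.fs := hs
        rcases hs'.gate h0 h1 hL hLN s.fs_cls (by rw [← hst]; exact t.fs_cls) hlt.le with hI | hG
        · rw [← hst] at hI
          exact ht hI
        · exact hlt.ne hG.1
      nlinarith
    · exact (Real.exp_pos _).le

lemma exists_escape_plus (β h : ℝ) {W : Set (HState L)} (hW : ∀ s ∈ W, s ∉ plusSet L) :
    ∀ s ∈ W, ∃ z, z ∉ W ∧ 0 < Kh β h s z := fun s _ =>
  ⟨hst (!s.1) Finset.univ, fun hm => hW _ hm (hst_univ_mem _), Kh_pos β h rfl⟩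

/-- The expected number of visits to `t` is bounded by the Green function on the diagonal. -/
lemma killedLaw_sum_le_green (β h : ℝ) {t : HState L} (ht : t ∉ plusSet L)
    {W : Set (HState L)} (hW : W = (plusSet L)ᶜ) {g : HState L → ℝ}
    (hg : ∀ x, g x = (if x = t then 1 else 0) + if x ∈ W then ∑ y, Kh β h x y * g y else 0) :
    0 ≤ g t ∧ ∀ x₀ N, ∑ n ∈ Finset.range N, killedLaw (Kh β h) (plusSet L) x₀ n t ≤ g t := by
  subst hW
  have hP := isStoch_Kh (L := L) β h
  have hgE : ∀ x ∈ plusSet L, g x = 0 := by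
    intro x hx
    have hxt : x ≠ t := fun he => ht (he ▸ hx)
    rw [hg x, if_neg hxt, if_neg (fun hc => hc hx), add_zero]
  have hg0 : ∀ x, 0 ≤ g x := by
    refine hP.min_principle (exists_escape_plus β h (W := (plusSet L)ᶜ) fun s hs => hs)
      (fun x hx => (hgE x (not_not.1 hx)).ge) fun x hx => ?_
    conv_rhs => rw [hg x, if_pos hx]
    split_ifs <;> linarith
  have hgt : ∀ x, g x ≤ g t := by
    have := hP.min_principle (W := {x | x ∉ plusSet L ∧ x ≠ t}) (φ := fun x => g t - g x)
      (exists_escape_plus β h fun s hs => hs.1) (fun x hx => ?_) fun x hx => ?_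
    · exact fun x => sub_nonneg.1 (this x)
    · by_cases hxE : x ∈ plusSet L
      · simp only [hgE x hxE, sub_zero, hg0]
      · have hxt : x = t := by
          by_contra hne
          exact hx ⟨hxE, hne⟩
        rw [hxt, sub_self]
    · simp only [mul_sub, Finset.sum_sub_distrib, ← Finset.sum_mul, hP.sum_one, one_mul]
      conv_rhs => rw [hg x, if_neg hx.2, if_pos (show x ∈ (plusSet L)ᶜ from hx.1), zero_add]
  refine ⟨hg0 t, fun x₀ N => ?_⟩
  have key := killedLaw_sum_le hP (plusSet L) x₀ (r := fun x => if x = t then 1 else 0) (φ := g)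
    (fun x => by
      conv_rhs => rw [hg x]
      by_cases hx : x ∈ plusSet L <;> simp [hx]) N
  simp only [mul_ite, mul_one, mul_zero, Finset.sum_ite_eq', Finset.mem_univ, if_true] at key
  have hnn : 0 ≤ ∑ x, killedLaw (Kh β h) (plusSet L) x₀ N x * g x :=
    Finset.sum_nonneg fun x _ => mul_nonneg (killedLaw_nonneg hP _ _ _ _) (hg0 x)
  linarith [hgt x₀]

/-- Every half configuration different from `-1` is joined to the plus phase below `Γ`. -/
lemma exists_path_plus {h : ℝ} (h0 : 0 < h) (h1 : h < 1) {b : ℕ} (hb2 : 2 ≤ b)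
    (hL : lam h * b < L) (hb : 4 * (lam h : ℝ) - (2 * h * lam h - 4) * (b : ℝ) ≤ 0)
    {t : HState L} (ht : t.fs.Nonempty) :
    ∃ v < Hn h (t.fs ∪ drift (!t.1) t.fs) + Gam h,
      Relation.ReflTransGen (HStep fun ω => Hn h ω ≤ v) t (hst t.1 Finset.univ) := by
  set ω := t.fs ∪ drift (!t.1) t.fs with hω
  set X := Hn h ω + Gam h with hX
  have hlt : Hn h ω < X := by linarith [Gam_pos h0 h1]
  obtain ⟨ω', hω', hmax⟩ := Finset.exists_max_image
    (Finset.univ.filter fun ω' : Finset (Site L) => Hn h ω' < X) (Hn h) ⟨ω, by simpa using hlt⟩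
  refine ⟨Hn h ω', (Finset.mem_filter.1 hω').2, ?_⟩
  have hgr := exists_growth h0 h1 hb2 hL hb (Fintype.card (Site L) - ω.card) ω
    (ht.mono Finset.subset_union_left) (Nat.sub_add_cancel (Finset.card_le_univ ω)) X le_rfl
  have hr := reach_hst_of_reach (G := fun ω => Hn h ω < X) hlt hgr t.1 t.1
  have hstart : hst t.1 ω = t := by
    refine HState.eq_of_fs rfl ?_
    rw [fs_hst, hω, Finset.filter_union, Finset.filter_true_of_mem t.fs_cls,
      Finset.filter_false_of_mem, Finset.union_empty]
    intro x hx
    rw [drift_cls _ _ x hx]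
    simp
  rw [hstart] at hr
  refine Relation.ReflTransGen.mono (fun s s' hs => ⟨hs.1, ?_⟩) _ _ hr
  exact hmax _ (by simpa using hs.2)

lemma πh_le {h : ℝ} (h0 : 0 < h) (h1 : h < 1) (hL : Even L) {β : ℝ} (hβ : 0 ≤ β) (t : HState L) :
    πh β h t ≤ (Fintype.card (HState L) : ℝ) *
      Real.exp (-β * Hn h (t.fs ∪ drift (!t.1) t.fs)) := by
  rw [← (isRev_half hL β h).sum_cond, ← nsmul_eq_mul]
  refine Finset.sum_le_card_nsmul _ _ _ fun s _ => ?_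
  unfold ch
  split_ifs with hst
  · refine Real.exp_le_exp.2 ?_
    have := Hn_drift_le h0 h1 hL t.fs_cls (b := s.fs) (by rw [← hst]; exact s.fs_cls)
    nlinarith
  · exact (Real.exp_pos _).le

/-- The expected number of visits to a half configuration different from `-1` is
negligible with respect to `exp (β Γ)`. -/
lemma exists_visits_bound {h : ℝ} (h0 : 0 < h) (h1 : h < 1) (hL : Even L) {b : ℕ} (hb2 : 2 ≤ b)
    (hLb : lam h * b < L) (hb : 4 * (lam h : ℝ) - (2 * h * lam h - 4) * (b : ℝ) ≤ 0)
    {t : HState L} (ht : t.fs.Nonempty) :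
    ∃ B : ℝ → ℝ, Tendsto (fun β => Real.exp (-β * Gam h) * B β) atTop (nhds 0) ∧
      ∀ β, 0 ≤ β → ∀ x₀ N,
        ∑ n ∈ Finset.range N, killedLaw (Kh β h) (plusSet L) x₀ n t ≤ B β := by
  have hG := Gam_pos h0 h1
  by_cases htE : t ∈ plusSet L
  · refine ⟨fun _ => 1, ?_, fun β _ x₀ N => ?_⟩
    · simp only [mul_one]
      exact tendsto_exp_neg_mul (by linarith)
    · have hP := isStoch_Kh (L := L) β h
      have key := killedLaw_sum_le hP (plusSet L) x₀ (r := fun x => if x = t then 1 else 0)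
        (φ := fun _ => 1) (fun x => by
          simp only [mul_one, hP.sum_one]
          by_cases hxt : x = t
          · simp [hxt, htE]
          · simp only [hxt, if_false, zero_add]
            split_ifs <;> norm_num) N
      simp only [mul_ite, mul_one, mul_zero, Finset.sum_ite_eq', Finset.mem_univ, if_true] at key
      have hnn : 0 ≤ ∑ x, killedLaw (Kh β h) (plusSet L) x₀ N x :=
        Finset.sum_nonneg fun x _ => killedLaw_nonneg hP _ _ _ _
      linarith
  · obtain ⟨v, hv, hpath⟩ := exists_path_plus h0 h1 hb2 hLb hb ht
    obtain ⟨n, hn⟩ := exists_variation_bound hpath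
    set H := Hn h (t.fs ∪ drift (!t.1) t.fs) with hH
    set M := (Fintype.card (HState L) : ℝ) with hM
    refine ⟨fun β => (n : ℝ) ^ 2 * (M * Real.exp (-β * H)) * Real.exp (β * v), ?_,
      fun β hβ x₀ N => ?_⟩
    · have := (tendsto_exp_neg_mul (d := H + Gam h - v) (by linarith)).const_mul ((n : ℝ) ^ 2 * M)
      rw [mul_zero] at this
      refine this.congr fun β => ?_
      have e : Real.exp (-β * (H + Gam h - v)) =
          Real.exp (-β * Gam h) * Real.exp (-β * H) * Real.exp (β * v) := by
        rw [← Real.exp_add, ← Real.exp_add]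
        congr 1
        ring
      rw [e]
      ring
    · have hR := isRev_half hL β h
      obtain ⟨g, hg⟩ := hR.stoch.exists_dirichlet
        (exists_escape_plus β h (W := (plusSet L)ᶜ) fun s hs => hs) fun x => if x = t then 1 else 0
      obtain ⟨hgt, hsum⟩ := killedLaw_sum_le_green β h htE rfl hg
      refine (hsum x₀ N).trans ?_
      have hplus : g (hst t.1 Finset.univ) = 0 := by
        have hne : hst t.1 Finset.univ ≠ t := fun he => htE (he ▸ hst_univ_mem t.1)
        rw [hg, if_neg hne, if_neg (fun hc => hc (hst_univ_mem t.1)), add_zero]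
      have hA : 0 ≤ πh β h t * g t * Real.exp (β * v) :=
        mul_nonneg (mul_nonneg (hR.pos t).le hgt) (Real.exp_pos _).le
      have hvar := hn g (Real.sqrt (πh β h t * g t * Real.exp (β * v))) fun x y hxy => by
        refine Real.abs_le_sqrt ?_
        have hedge := hR.green_edge htE (fun x => by convert hg x) x y
        have hc : Real.exp (-(β * v)) ≤ ch β h x y := by
          unfold ch
          rw [if_pos hxy.1]
          refine Real.exp_le_exp.2 ?_
          have := hxy.2
          nlinarith
        have h2 := (mul_le_mul_of_nonneg_right hc (sq_nonneg (g x - g y))).trans hedge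
        have h3 := mul_le_mul_of_nonneg_right h2 (Real.exp_pos (β * v)).le
        have e : Real.exp (-(β * v)) * Real.exp (β * v) = 1 := by
          rw [← Real.exp_add]; simp
        calc (g x - g y) ^ 2 = Real.exp (-(β * v)) * (g x - g y) ^ 2 * Real.exp (β * v) := by
              linear_combination -(g x - g y) ^ 2 * e
          _ ≤ _ := h3
      rw [hplus, sub_zero, abs_of_nonneg hgt] at hvar
      have hsq : g t * g t ≤ (n : ℝ) ^ 2 * πh β h t * Real.exp (β * v) * g t := by
        have := mul_self_le_mul_self hgt hvar
        rw [mul_mul_mul_comm, Real.mul_self_sqrt hA] at this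
        linarith
      have hbound : g t ≤ (n : ℝ) ^ 2 * πh β h t * Real.exp (β * v) := by
        rcases hgt.eq_or_lt with he | hpos
        · rw [← he]
          have := hR.pos t
          positivity
        · exact le_of_mul_le_mul_right hsq hpos
      refine hbound.trans ?_
      exact mul_le_mul_of_nonneg_right (mul_le_mul_of_nonneg_left (πh_le h0 h1 hL hβ t)
        (sq_nonneg _)) (Real.exp_pos _).le

end

section

variable {L : ℕ} [NeZero L]

lemma sum_config {F G : HState L → ℝ} (hF : ∀ s, s.1 ≠ true → F s = 0)
    (hG : ∀ s, s.1 ≠ false → G s = 0) :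
    ∑ σ : Config L, F (res true σ) * G (res false σ) = (∑ s, F s) * ∑ s, G s := by
  rw [Finset.sum_mul_sum, ← Finset.sum_product']
  refine Finset.sum_of_injOn (fun σ : Config L => (res true σ, res false σ))
    (fun σ _ η _ hση => ?_) (fun σ _ => by simp) (fun st _ hst => ?_) fun σ _ => rfl
  · exact config_ext_res true (congrArg Prod.fst hση) (congrArg Prod.snd hση)
  · obtain ⟨s, t⟩ := st
    by_cases hs : s.1 = true
    · by_cases ht : t.1 = false
      · refine absurd ⟨fun x => if chessE L x = true then s.ext x else t.ext x, by simp, ?_⟩ hst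
        have e1 : res true (fun x => if chessE L x = true then s.ext x else t.ext x) = s := by
          refine (res_eq_iff.2 (Finset.ext fun x => ?_)).trans (hs ▸ res_ext s)
          simp only [mem_fs_res]
          by_cases hx : chessE L x = true <;> simp [hx]
        have e2 : res false (fun x => if chessE L x = true then s.ext x else t.ext x) = t := by
          refine (res_eq_iff.2 (Finset.ext fun x => ?_)).trans (ht ▸ res_ext t)
          simp only [mem_fs_res]
          by_cases hx : chessE L x = true <;> simp [hx]
        exact Prod.ext e1 e2
      · simp [hG t ht]
    · simp [hF s hs]

/-- The configurations with one parity class full of pluses. -/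
def fullSet (L : ℕ) [NeZero L] : Set (Config L) :=
  {σ | res true σ ∈ plusSet L ∨ res false σ ∈ plusSet L}

/-- The law of a half chain started from `-1` and killed at the plus phase. -/
noncomputable def halfLaw (β h : ℝ) (L : ℕ) [NeZero L] (p : Bool) : ℕ → HState L → ℝ :=
  killedLaw (Kh β h) (plusSet L) (hst p ∅)

lemma halfLaw_nonneg (β h : ℝ) (p : Bool) (n : ℕ) (s : HState L) : 0 ≤ halfLaw β h L p n s :=
  killedLaw_nonneg (isStoch_Kh β h) _ _ _ _

lemma Kh_eq_zero (β h : ℝ) {s t : HState L} (hst : t.1 ≠ !s.1) : Kh β h s t = 0 := by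
  unfold Kh
  rw [if_neg hst]

lemma killedLaw_Pmat (hL : Even L) (β h : ℝ) (n : ℕ) (σ : Config L) :
    killedLaw (Pmat β h) (fullSet L) (minusC L) n σ =
      halfLaw β h L true n (res true σ) * halfLaw β h L false n (res false σ) +
      halfLaw β h L true n (res false σ) * halfLaw β h L false n (res true σ) := by
  induction n generalizing σ with
  | zero =>
    have hm : ∀ p, res p (minusC L) = hst p ∅ := fun p => by
      rw [← ext_hst_empty p]
      exact res_ext (hst p ∅)
    have h1 : res false σ ≠ hst true ∅ := fun he => by simpa using congrArg Sigma.fst he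
    have h2 : σ = minusC L ↔ res true σ = hst true ∅ ∧ res false σ = hst false ∅ := by
      rw [← hm, ← hm]
      exact ⟨fun he => by simp [he], fun he => config_ext_res true he.1 he.2⟩
    simp only [killedLaw, halfLaw, h1, if_false, zero_mul, add_zero, h2]
    by_cases h3 : res true σ = hst true ∅ <;> by_cases h4 : res false σ = hst false ∅ <;>
      simp [h3, h4]
  | succ n ih =>
    set v : Bool → HState L → ℝ := fun p s => if s ∈ plusSet L then 0 else halfLaw β h L p n s
      with hv
    have hrec : ∀ p s, halfLaw β h L p (n + 1) s = ∑ t, v p t * Kh β h t s := by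
      intro p s
      simp only [halfLaw, killedLaw, hv, ite_mul, zero_mul]
    have hsplit : ∀ p q, (∑ t, v p t * Kh β h t (res false σ)) *
        (∑ t, v q t * Kh β h t (res true σ)) =
        ∑ η, v p (res true η) * v q (res false η) * Pmat β h η σ := by
      intro p q
      rw [← sum_config]
      · refine Finset.sum_congr rfl fun η _ => ?_
        rw [Pmat_eq hL]
        ring
      · intro s hs
        rw [Kh_eq_zero, mul_zero]
        simpa [res_fst] using hs
      · intro s hs
        rw [Kh_eq_zero, mul_zero]
        simpa [res_fst] using hs
    rw [hrec, hrec, hrec, hrec, mul_comm (∑ t, v true t * Kh β h t (res true σ)), hsplit, hsplit,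
      ← Finset.sum_add_distrib]
    simp only [killedLaw]
    refine Finset.sum_congr rfl fun η _ => ?_
    split_ifs with hη
    · rcases hη with hη | hη <;> simp [hv, hη]
    · have hη' : res true η ∉ plusSet L ∧ res false η ∉ plusSet L := not_or.1 hη
      simp only [hv, hη'.1, hη'.2, if_false]
      rw [ih]
      ring

/-- Reaching simultaneously the plus phase on one class and a half configuration
different from `-1` on the other one is unlikely. -/
lemma exists_bound_full {h : ℝ} (h0 : 0 < h) (h1 : h < 1) (hL : Even L) (hLN : critN h + 1 < L)
    {b : ℕ} (hb2 : 2 ≤ b) (hLb : lam h * b < L)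
    (hb : 4 * (lam h : ℝ) - (2 * h * lam h - 4) * (b : ℝ) ≤ 0)
    {σ : Config L} (hσ : σ ∈ fullSet L) (hσ' : σ ∉ chessSet L) :
    ∃ B : ℝ → ℝ, Tendsto B atTop (nhds 0) ∧ ∀ β, 0 ≤ β → ∀ N,
      ∑ n ∈ Finset.range N, killedLaw (Pmat β h) (fullSet L) (minusC L) n σ ≤ B β := by
  obtain ⟨p, hp⟩ : ∃ p, res p σ = hst p Finset.univ := by
    rcases hσ with hσ | hσ
    · exact ⟨true, hσ⟩
    · exact ⟨false, hσ⟩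
  have hne : (res (!p) σ).fs.Nonempty := by
    by_contra hemp
    rw [Finset.not_nonempty_iff_eq_empty] at hemp
    refine hσ' ?_
    have hon : ∀ x, chessE L x = p → σ x = true := by
      intro x hx
      have : x ∈ (res p σ).fs := by
        rw [hp, fs_hst]
        simpa using hx
      exact (mem_fs_res.1 this).1
    have hoff : ∀ x, chessE L x = !p → σ x = false := by
      intro x hx
      by_contra hc
      have : x ∈ (res (!p) σ).fs := mem_fs_res.2 ⟨by simpa using hc, hx⟩
      rw [hemp] at this
      simp at this
    have hall : ∀ x, σ x = (chessE L x == p) := by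
      intro x
      by_cases hx : chessE L x = p
      · simp [hx, hon x hx]
      · rw [hoff x (by revert hx; cases chessE L x <;> cases p <;> simp)]
        simp [hx]
    cases p
    · refine Or.inr (funext fun x => ?_)
      rw [hall]
      simp [chessO]
    · refine Or.inl (funext fun x => ?_)
      rw [hall]
      simp
  obtain ⟨B, hB, hBv⟩ := exists_visits_bound h0 h1 hL hb2 hLb hb hne
  set M := (Fintype.card (HState L) : ℝ) ^ 2 with hM
  refine ⟨fun β => 2 * M * (Real.exp (-β * Gam h) * B β), ?_, fun β hβ N => ?_⟩
  · simpa using hB.const_mul (2 * M)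
  · have hterm : ∀ n, killedLaw (Pmat β h) (fullSet L) (minusC L) n σ ≤
        M * Real.exp (-β * Gam h) *
          (halfLaw β h L true n (res (!p) σ) + halfLaw β h L false n (res (!p) σ)) := by
      intro n
      have hk : ∀ q, halfLaw β h L q n (res p σ) ≤ M * Real.exp (-β * Gam h) := fun q => by
        rw [hp]
        exact killedLaw_plus_le h0 h1 hL hLN hβ q p n
      have e1 := mul_le_mul_of_nonneg_right (hk true)
        (halfLaw_nonneg β h false n (res (!p) σ))
      have e2 := mul_le_mul_of_nonneg_right (hk false)
        (halfLaw_nonneg β h true n (res (!p) σ))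
      rw [killedLaw_Pmat hL]
      cases p <;> simp only [Bool.not_true, Bool.not_false] at e1 e2 ⊢ <;> linarith
    refine (Finset.sum_le_sum fun n _ => hterm n).trans ?_
    rw [← Finset.mul_sum, Finset.sum_add_distrib]
    have e1 := hBv β hβ (hst true ∅) N
    have e2 := hBv β hβ (hst false ∅) N
    calc _ ≤ M * Real.exp (-β * Gam h) * (B β + B β) :=
          mul_le_mul_of_nonneg_left (add_le_add e1 e2) (by positivity)
      _ = _ := by ring

lemma plusC_mem_fullSet : plusC L ∈ fullSet L := by
  refine Or.inl (HState.eq_of_fs rfl ?_)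
  rw [fs_res, fs_hst]
  congr 1
  ext x
  simp [mem_pl, plusC]

lemma plusC_notMem_chessSet (hL : Even L) : plusC L ∉ chessSet L := by
  have hpos : 0 < L := Nat.pos_of_ne_zero (NeZero.ne L)
  have hex : ∀ q, ∃ x, chessE L x = q := by
    intro q
    obtain ⟨x, hx⟩ := Finset.card_pos.1 (hpos.trans_le (le_card_class hL q))
    exact ⟨x, (Finset.mem_filter.1 hx).2⟩
  rintro (he | he)
  · obtain ⟨x, hx⟩ := hex false
    have := congrFun he x
    simp [plusC, hx] at this
  · obtain ⟨x, hx⟩ := hex true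
    have := congrFun he x
    simp [plusC, chessO, hx] at this

theorem tendsto_chessSet {h : ℝ} (h0 : 0 < h) (h1 : h < 1) (hL : Even L) (hLN : critN h + 1 < L)
    {b : ℕ} (hb2 : 2 ≤ b) (hLb : lam h * b < L)
    (hb : 4 * (lam h : ℝ) - (2 * h * lam h - 4) * (b : ℝ) ≤ 0) :
    Tendsto (fun β : ℝ => probHitBefore β h (minusC L) (chessSet L) {plusC L})
      atTop (nhds 1) := by
  have hex : ∀ σ : Config L, ∃ B : ℝ → ℝ, Tendsto B atTop (nhds 0) ∧ ∀ β, 0 ≤ β → ∀ N,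
      ∑ n ∈ Finset.range N, killedLaw (Pmat β h) (fullSet L) (minusC L) n σ *
        (if σ ∈ fullSet L ∧ σ ∉ chessSet L then 1 else 0) ≤ B β := by
    intro σ
    by_cases hσ : σ ∈ fullSet L ∧ σ ∉ chessSet L
    · simp only [if_pos hσ, mul_one]
      exact exists_bound_full h0 h1 hL hLN hb2 hLb hb hσ.1 hσ.2
    · refine ⟨fun _ => 0, tendsto_const_nhds, fun β _ N => ?_⟩
      simp [hσ]
  choose B hB hBv using hex
  have hlow : ∀ β : ℝ, 0 ≤ β → 1 - ∑ σ, B σ β ≤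
      probHitBefore β h (minusC L) (chessSet L) {plusC L} ∧
      probHitBefore β h (minusC L) (chessSet L) {plusC L} ≤ 1 := by
    intro β hβ
    have hP := isStoch_Pmat (L := L) β h
    set W := {σ | σ ∉ fullSet L} with hW
    set r : Config L → ℝ := fun σ => if σ ∈ fullSet L ∧ σ ∉ chessSet L then 1 else 0 with hr
    have hesc : ∀ x ∈ W, ∃ z, z ∉ W ∧ 0 < Pmat β h x z := fun x _ =>
      ⟨plusC L, fun hw => hw plusC_mem_fullSet, Pmat_pos β h x _⟩
    obtain ⟨f, hf⟩ := hP.exists_dirichlet hesc r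
    have hfW : ∀ x ∈ W, f x = ∑ y, Pmat β h x y * f y := by
      intro x hx
      have hrx : r x = 0 := if_neg fun hc => hx hc.1
      rw [hf x, hrx, if_pos hx, zero_add]
    have hfo : ∀ x ∉ W, f x = r x := by
      intro x hx
      rw [hf x, if_neg hx, add_zero]
    have hr01 : ∀ x, 0 ≤ r x ∧ r x ≤ 1 := by
      intro x
      simp only [hr]
      split_ifs <;> norm_num
    have hf0 : ∀ x, 0 ≤ f x :=
      hP.min_principle hesc (fun x hx => (hfo x hx).symm ▸ (hr01 x).1) fun x hx => (hfW x hx).ge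
    have hf1 : ∀ x, f x ≤ 1 := by
      have := hP.min_principle (φ := fun x => 1 - f x) hesc (fun x hx => ?_) fun x hx => ?_
      · exact fun x => sub_nonneg.1 (this x)
      · simp only [hfo x hx, sub_nonneg, (hr01 x).2]
      · simp only [mul_sub, mul_one, Finset.sum_sub_distrib, hP.sum_one]
        rw [← hfW x hx]
    have hs := one_sub_le_probHitBefore β h (minusC L) (A := chessSet L) (B := {plusC L})
      ⟨_, rfl⟩ hf0 (fun x hx => by
        obtain rfl : x = plusC L := hx
        rw [hfo _ fun hw => hw plusC_mem_fullSet]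
        exact (if_pos ⟨plusC_mem_fullSet, plusC_notMem_chessSet hL⟩).ge)
      (fun x hxC _ => by
        by_cases hxW : x ∈ W
        · exact (hfW x hxW).ge
        · rw [hfo x hxW, show r x = 1 from if_pos ⟨not_not.1 hxW, hxC⟩]
          calc _ ≤ ∑ y, Pmat β h x y * 1 := Finset.sum_le_sum fun y _ =>
                mul_le_mul_of_nonneg_left (hf1 y) (Pmat_pos β h x y).le
            _ = 1 := by simp only [mul_one, hP.sum_one])
    refine ⟨?_, hs.2⟩
    have hle := harmonic_le_of_killedLaw β h (minusC L) (K := fullSet L) (r := r)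
      ⟨_, plusC_mem_fullSet⟩ hf1 (fun x => by
        rw [hf x]
        by_cases hx : x ∈ fullSet L <;> simp [hW, hx]) (b := ∑ σ, B σ β) fun N => by
        rw [Finset.sum_comm]
        exact Finset.sum_le_sum fun σ _ => hBv σ β hβ N
    linarith [hs.1]
  have hlim : Tendsto (fun β : ℝ => 1 - ∑ σ, B σ β) atTop (nhds 1) := by
    have := (tendsto_finsetSum Finset.univ fun σ _ => hB σ).const_sub (1 : ℝ)
    simpa using this
  refine tendsto_of_tendsto_of_tendsto_of_le_of_le' hlim tendsto_const_nhds ?_ ?_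
  · filter_upwards [eventually_ge_atTop 0] with β hβ using (hlow β hβ).1
  · filter_upwards [eventually_ge_atTop 0] with β hβ using (hlow β hβ).2

end

/-- Theorem 3.9, parts i–ii: starting from `-1`, the system
visits the protocritical droplets before the chessboards, and the chessboards
before `+1`. -/
theorem exit_path_from_minus :
    ∃ h₀ : ℝ, 0 < h₀ ∧ h₀ ≤ 2 ∧
    ∀ h : ℝ, 0 < h → h < h₀ → (∀ z : ℤ, (z : ℝ) ≠ 2 / h) →
    ∃ L₀ : ℕ, ∀ (L : ℕ) [NeZero L], Even L → L₀ ≤ L →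
      Tendsto (fun β : ℝ =>
          probHitBefore β h (minusC L) (ProtoSet h L) (chessSet L))
        atTop (nhds 1) ∧
      Tendsto (fun β : ℝ =>
          probHitBefore β h (minusC L) (chessSet L) {plusC L})
        atTop (nhds 1) := by
  refine ⟨1, one_pos, one_le_two, fun h h0 h1 _ => ?_⟩
  obtain ⟨-, hlt, -⟩ := lam_facts h0 h1
  have hD : 0 < 2 * h * lam h - 4 := by linarith
  obtain ⟨m, hm⟩ := exists_nat_ge (4 * (lam h : ℝ) / (2 * h * lam h - 4))
  rw [div_le_iff₀ hD] at hm
  have hb : 4 * (lam h : ℝ) - (2 * h * lam h - 4) * ((m + 2 : ℕ) : ℝ) ≤ 0 := by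
    push_cast
    nlinarith
  refine ⟨lam h * (m + 2) + 2 * critN h + 2, fun L _ hL hLL => ⟨?_, ?_⟩⟩
  · exact tendsto_protoSet h0 h1 hL (by omega)
  · exact tendsto_chessSet h0 h1 hL (by omega) (by omega) (by omega) hb

end PCA
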